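/- arXiv:2008.06349 — 2 statements merged into one kernel-verified Lean document; each statement's English description precedes it below -/
import Mathlib

section
/- For every α > 0 the following are equivalent: (a) the function x ↦ −h_α″(x)/h_α′(x) is completely monotonic on (0,∞), where h_α(x) = exp(αx·log(1 + 1/x)); (b) G_α(x) ≥ 0 for all x > 0, where G_α(x) = 2 + Σ_{n=1}^∞ (xⁿ/n!)·(t_n − α/(n+1)) and t_n = ∫₀¹ sⁿ τ₀(1−s) ds. -/
/-- A function `u : ℝ → ℝ` is completely monotonic on `(0,∞)` if it is infinitely
differentiable there and `(-1)^n u^{(n)}(x) ≥ 0` for all `x > 0` and all `n ≥ 0`. -/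
def CompletelyMonotonicOn (u : ℝ → ℝ) : Prop :=
  ContDiffOn ℝ (⊤ : ℕ∞) u (Set.Ioi 0) ∧
  ∀ (n : ℕ), ∀ x ∈ Set.Ioi (0 : ℝ), 0 ≤ (-1 : ℝ) ^ n * iteratedDerivWithin n u (Set.Ioi 0) x

/-- `h_α(x) = exp(αx·log(1 + 1/x))`. -/
noncomputable def hfun (α : ℝ) (x : ℝ) : ℝ := Real.exp (α * x * Real.log (1 + 1 / x))

/-- The density `τ₀(t) = ( t[(1−t)log((1−t)/t) − 1]² + π² t (1−t)² )⁻¹` for `0 < t < 1`. -/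
noncomputable def tau0 (t : ℝ) : ℝ :=
  (t * ((1 - t) * Real.log ((1 - t) / t) - 1) ^ 2 + Real.pi ^ 2 * t * (1 - t) ^ 2)⁻¹

/-- The moments `t_n = ∫₀¹ sⁿ τ₀(1−s) ds`. -/
noncomputable def tmom (n : ℕ) : ℝ := ∫ s in (0 : ℝ)..1, s ^ n * tau0 (1 - s)

/-- `G_α(x) = 2 + Σ_{n=1}^∞ (xⁿ/n!)·(t_n − α/(n+1))`. -/
noncomputable def Gfun (α : ℝ) (x : ℝ) : ℝ :=
  2 + ∑' n : ℕ, x ^ (n + 1) / (Nat.factorial (n + 1) : ℝ) *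
    (tmom (n + 1) - α / ((n : ℝ) + 2))


open MeasureTheory Set Filter Topology

section Contour

/-- `w e^w - e^w + 1` vanishes only at `0` in the closed strip `|Im w| ≤ π`. -/
lemma mul_exp_sub_exp_add_one_ne_zero {w : ℂ} (hw : w ≠ 0) (him : |w.im| ≤ Real.pi) :
    w * Complex.exp w - Complex.exp w + 1 ≠ 0 := by
  intro h
  have h1 : w - 1 + Complex.exp (-w) = 0 := by
    have h2 : Complex.exp w * Complex.exp (-w) = 1 := by
      rw [← Complex.exp_add]; simp
    linear_combination (Complex.exp (-w)) * h - (w - 1) * h2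
  have hre := congrArg Complex.re h1
  have hi := congrArg Complex.im h1
  simp only [Complex.add_re, Complex.sub_re, Complex.one_re, Complex.exp_re, Complex.neg_re,
    Complex.neg_im, Real.cos_neg, Complex.zero_re] at hre
  simp only [Complex.add_im, Complex.sub_im, Complex.one_im, Complex.exp_im, Complex.neg_re,
    Complex.neg_im, Real.sin_neg, Complex.zero_im] at hi
  set u := w.re
  set v := w.im
  have key : ∀ v : ℝ, 0 < v → v ≤ Real.pi → u - 1 + Real.exp (-u) * Real.cos v = 0 →
      v = Real.exp (-u) * Real.sin v → False := by
    intro v hv hvp hre hi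
    have hs : Real.sin v < v := Real.sin_lt hv
    have he := Real.exp_pos (-u)
    have hs0 : 0 < Real.sin v := by
      by_contra hcon
      nlinarith
    have hu : 1 < Real.exp (-u) := by
      by_contra hcon
      nlinarith
    have hu' : u < 0 := by
      rw [Real.one_lt_exp_iff] at hu; linarith
    have hc : 0 < Real.cos v := by
      by_contra hcon
      nlinarith
    have hv2 : v < Real.pi / 2 := by
      by_contra hcon
      have := Real.cos_nonpos_of_pi_div_two_le_of_le (not_lt.1 hcon) (by linarith)
      linarith
    have ht := Real.lt_tan hv hv2
    rw [Real.tan_eq_sin_div_cos, lt_div_iff₀ hc] at ht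
    have h3 : (1 - u) * Real.sin v = v * Real.cos v := by
      linear_combination (-Real.sin v) * hre - Real.cos v * hi
    nlinarith
  rcases lt_trichotomy v 0 with hv | hv | hv
  · refine key (-v) (by linarith) ?_ (by rw [Real.cos_neg]; exact hre) ?_
    · rw [abs_of_neg hv] at him; exact him
    · rw [Real.sin_neg]; linarith
  · rw [hv, Real.cos_zero] at hre
    have hu : u ≠ 0 := by
      intro hu
      exact hw (Complex.ext hu hv)
    have := Real.add_one_lt_exp (neg_ne_zero.2 hu)
    linarith
  · refine key v hv ?_ hre (by linarith)
    rw [abs_of_pos hv] at him; exact him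

/-- The entire function `(e^w - 1) / w`. -/
noncomputable def expQuot : ℂ → ℂ := dslope Complex.exp 0

/-- The entire function `(w e^w - e^w + 1) / w ^ 2`. -/
noncomputable def expQuot₂ (w : ℂ) : ℂ := expQuot w - dslope expQuot 0 w

/-- The function `(e^w - 1) ^ 2 / (w e^w - e^w + 1)` with its singularity at `0` removed. -/
noncomputable def stripKernel (w : ℂ) : ℂ := expQuot w ^ 2 / expQuot₂ w

lemma differentiable_dslope {f : ℂ → ℂ} (hf : Differentiable ℂ f) (c : ℂ) :
    Differentiable ℂ (dslope f c) := by
  rw [← differentiableOn_univ]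
  exact (Complex.differentiableOn_dslope univ_mem).2 hf.differentiableOn

lemma differentiable_expQuot : Differentiable ℂ expQuot :=
  differentiable_dslope Complex.differentiable_exp 0

lemma differentiable_expQuot₂ : Differentiable ℂ expQuot₂ :=
  differentiable_expQuot.sub (differentiable_dslope differentiable_expQuot 0)

lemma expQuot_zero : expQuot 0 = 1 := by simp [expQuot]

lemma mul_expQuot (w : ℂ) : w * expQuot w = Complex.exp w - 1 := by
  have := sub_smul_dslope Complex.exp 0 w
  simpa [expQuot] using this

lemma sq_mul_expQuot₂ (w : ℂ) :
    w ^ 2 * expQuot₂ w = w * Complex.exp w - Complex.exp w + 1 := by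
  have h := sub_smul_dslope expQuot 0 w
  simp only [sub_zero, smul_eq_mul, expQuot_zero] at h
  have h1 := mul_expQuot w
  rw [expQuot₂]
  linear_combination (w - 1) * h1 - w * h

lemma deriv_expQuot_zero : deriv expQuot 0 = 1 / 2 := by
  have h1 : ∀ w, expQuot w + w * deriv expQuot w = Complex.exp w := by
    intro w
    have ha : HasDerivAt (fun w => w * expQuot w) (1 * expQuot w + w * deriv expQuot w) w :=
      (hasDerivAt_id w).mul (differentiable_expQuot w).hasDerivAt
    have hb : HasDerivAt (fun w => w * expQuot w) (Complex.exp w) w := by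
      rw [funext mul_expQuot]
      exact (Complex.hasDerivAt_exp w).sub_const 1
    rw [← ha.unique hb, one_mul]
  have hd : Differentiable ℂ (deriv expQuot) := differentiable_expQuot.deriv
  have ha : HasDerivAt (fun w => expQuot w + w * deriv expQuot w)
      (deriv expQuot 0 + (1 * deriv expQuot 0 + 0 * deriv (deriv expQuot) 0)) 0 :=
    (differentiable_expQuot 0).hasDerivAt.add ((hasDerivAt_id (0 : ℂ)).mul (hd 0).hasDerivAt)
  have hb : HasDerivAt (fun w => expQuot w + w * deriv expQuot w) (Complex.exp 0) 0 := by
    rw [funext h1]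
    exact Complex.hasDerivAt_exp 0
  have := ha.unique hb
  rw [Complex.exp_zero] at this
  linear_combination this / 2

lemma expQuot₂_zero : expQuot₂ 0 = 1 / 2 := by
  rw [expQuot₂, expQuot_zero, dslope_same, deriv_expQuot_zero]; norm_num

lemma stripKernel_zero : stripKernel 0 = 2 := by
  rw [stripKernel, expQuot_zero, expQuot₂_zero]; norm_num

lemma stripKernel_of_ne_zero {w : ℂ} (hw : w ≠ 0) :
    stripKernel w =
      (Complex.exp w - 1) ^ 2 / (w * Complex.exp w - Complex.exp w + 1) := by
  rw [← mul_expQuot, ← sq_mul_expQuot₂, stripKernel, mul_pow,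
    mul_div_mul_left _ _ (pow_ne_zero 2 hw)]

lemma expQuot₂_ne_zero {w : ℂ} (him : |w.im| ≤ Real.pi) : expQuot₂ w ≠ 0 := by
  by_cases hw : w = 0
  · rw [hw, expQuot₂_zero]; norm_num
  · intro h
    apply mul_exp_sub_exp_add_one_ne_zero hw him
    rw [← sq_mul_expQuot₂, h, mul_zero]

lemma dslope_exp_ofReal_ne_zero (a : ℝ) {w : ℂ} (him : |w.im| ≤ Real.pi) :
    dslope Complex.exp a w ≠ 0 := by
  by_cases hw : w = a
  · rw [hw, dslope_same]; simp
  · rw [dslope_of_ne _ hw, slope_def_field]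
    refine div_ne_zero ?_ (sub_ne_zero.2 hw)
    intro h
    rw [sub_eq_zero, Complex.exp_eq_exp_iff_exists_int] at h
    obtain ⟨n, hn⟩ := h
    have hi := congrArg Complex.im hn
    simp at hi
    have hn0 : n = 0 := by
      rw [hi, abs_mul, abs_of_pos (by positivity : (0:ℝ) < 2 * Real.pi)] at him
      have : |(n : ℝ)| < 1 := by
        by_contra hcon
        nlinarith [Real.pi_pos]
      have h' : |n| < 1 := by exact_mod_cast this
      exact Int.abs_lt_one_iff.1 h'
    apply hw
    rw [hn, hn0]; simp

/-- The function `(k(w) - k(a)) / (e^a - e^w)`, where `k` is `stripKernel`, with its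
singularity at `a` removed. -/
noncomputable def stripIntegrand (a : ℝ) (w : ℂ) : ℂ :=
  -dslope stripKernel a w / dslope Complex.exp a w

lemma stripIntegrand_of_ne {a : ℝ} {w : ℂ} (hw : w ≠ a) :
    stripIntegrand a w =
      (stripKernel w - stripKernel a) / (Complex.exp a - Complex.exp w) := by
  rw [stripIntegrand, dslope_of_ne _ hw, dslope_of_ne _ hw, slope_def_field, slope_def_field,
    ← neg_div, div_div_div_cancel_right₀ (sub_ne_zero.2 hw), ← neg_sub (Complex.exp w), div_neg,
    neg_div]

lemma differentiableAt_stripIntegrand (a : ℝ) {w : ℂ} (him : |w.im| ≤ Real.pi) :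
    DifferentiableAt ℂ (stripIntegrand a) w := by
  have hopen : IsOpen {w : ℂ | expQuot₂ w ≠ 0} :=
    isOpen_ne_fun differentiable_expQuot₂.continuous continuous_const
  have hk : DifferentiableOn ℂ stripKernel {w : ℂ | expQuot₂ w ≠ 0} := fun z hz =>
    (((differentiable_expQuot z).pow 2).div (differentiable_expQuot₂ z)
      hz).differentiableWithinAt
  have ha : (a : ℂ) ∈ {w : ℂ | expQuot₂ w ≠ 0} :=
    expQuot₂_ne_zero (by simpa using Real.pi_pos.le)
  have hs := (Complex.differentiableOn_dslope (hopen.mem_nhds ha)).2 hk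
  have hs' := hs.differentiableAt (hopen.mem_nhds (expQuot₂_ne_zero him))
  exact hs'.neg.div (differentiable_dslope Complex.differentiable_exp a w)
    (dslope_exp_ofReal_ne_zero a him)

/-- The filter of points of the strip `|Im w| ≤ π` whose real part tends along `l`. -/
def stripFilter (l : Filter ℝ) : Filter ℂ :=
  comap Complex.re l ⊓ 𝓟 {w | |w.im| ≤ Real.pi}

lemma tendsto_re_stripFilter (l : Filter ℝ) : Tendsto Complex.re (stripFilter l) l :=
  tendsto_comap.mono_left inf_le_left

lemma eventually_im_stripFilter (l : Filter ℝ) : ∀ᶠ w in stripFilter l, |w.im| ≤ Real.pi :=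
  mem_inf_of_right (mem_principal_self _)

lemma tendsto_stripIntegrand_right (a : ℝ) :
    Tendsto (stripIntegrand a) (stripFilter atTop) (𝓝 0) := by
  have hre := tendsto_re_stripFilter atTop
  have he : Tendsto (fun w : ℂ => Complex.exp (-w)) (stripFilter atTop) (𝓝 0) := by
    rw [tendsto_zero_iff_norm_tendsto_zero]
    simp only [Complex.norm_exp, Complex.neg_re]
    exact Real.tendsto_exp_neg_atTop_nhds_zero.comp hre
  have hn : Tendsto (fun w : ℂ => w⁻¹) (stripFilter atTop) (𝓝 0) := by
    apply tendsto_inv₀_cobounded.comp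
    rw [← tendsto_norm_atTop_iff_cobounded]
    exact tendsto_atTop_mono (fun w => (le_abs_self _).trans (Complex.abs_re_le_norm w)) hre
  have hlim : Tendsto (fun w : ℂ =>
      (1 - Complex.exp (-w)) ^ 2 * w⁻¹ / ((1 - w⁻¹ + Complex.exp (-w) * w⁻¹) *
        (Complex.exp a * Complex.exp (-w) - 1)) -
        stripKernel a * Complex.exp (-w) / (Complex.exp a * Complex.exp (-w) - 1))
      (stripFilter atTop) (𝓝 ((1 - 0) ^ 2 * 0 / ((1 - 0 + 0 * 0) * (Complex.exp a * 0 - 1)) -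
        stripKernel a * 0 / (Complex.exp a * 0 - 1))) := by
    refine Tendsto.sub (Tendsto.div ?_ ?_ (by norm_num)) (Tendsto.div ?_ ?_ (by norm_num))
    · exact ((tendsto_const_nhds.sub he).pow 2).mul hn
    · exact ((tendsto_const_nhds.sub hn).add (he.mul hn)).mul
        ((tendsto_const_nhds.mul he).sub tendsto_const_nhds)
    · exact tendsto_const_nhds.mul he
    · exact (tendsto_const_nhds.mul he).sub tendsto_const_nhds
  simp only [mul_zero, zero_div, sub_zero] at hlim
  refine hlim.congr' ?_
  filter_upwards [hre.eventually_gt_atTop (max a 0), eventually_im_stripFilter atTop] with w hw him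
  have hwa : w ≠ a := by
    rintro rfl
    have := (le_max_left a 0).trans_lt hw
    simp at this
  have hw0 : w ≠ 0 := by
    rintro rfl
    have := (le_max_right a 0).trans_lt hw
    simp at this
  have hE : Complex.exp a - Complex.exp w ≠ 0 := by
    intro h
    have h' := congrArg norm (sub_eq_zero.1 h)
    rw [Complex.norm_exp, Complex.norm_exp, Real.exp_eq_exp, Complex.ofReal_re] at h'
    have := (le_max_left a 0).trans_lt hw
    linarith
  have hD := mul_exp_sub_exp_add_one_ne_zero hw0 him
  rw [stripIntegrand_of_ne hwa, sub_div, stripKernel_of_ne_zero hw0]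
  have hv := Complex.exp_ne_zero w
  rw [Complex.exp_neg]
  have e1 : Complex.exp a * (Complex.exp w)⁻¹ - 1 =
      (Complex.exp a - Complex.exp w) / Complex.exp w := by field_simp
  have e2 : 1 - w⁻¹ + (Complex.exp w)⁻¹ * w⁻¹ =
      (w * Complex.exp w - Complex.exp w + 1) / (w * Complex.exp w) := by field_simp
  rw [e1, e2]
  field_simp

lemma tendsto_stripIntegrand_left (a : ℝ) :
    Tendsto (stripIntegrand a) (stripFilter atBot)
      (𝓝 ((1 - stripKernel a) / Complex.exp a)) := by
  have hre := tendsto_re_stripFilter atBot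
  have he : Tendsto (fun w : ℂ => Complex.exp w) (stripFilter atBot) (𝓝 0) := by
    rw [tendsto_zero_iff_norm_tendsto_zero]
    simp only [Complex.norm_exp]
    exact Real.tendsto_exp_atBot.comp hre
  have hm : Tendsto (fun w : ℂ => w * Complex.exp w) (stripFilter atBot) (𝓝 0) := by
    have h1 : Tendsto (fun r : ℝ => (|r| + Real.pi) * Real.exp r) atBot (𝓝 0) := by
      have h2 : Tendsto (fun r : ℝ => r * Real.exp (-r) + Real.pi * Real.exp (-r)) atTop
          (𝓝 (0 + Real.pi * 0)) := by
        refine Tendsto.add ?_ (Real.tendsto_exp_neg_atTop_nhds_zero.const_mul _)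
        simpa using Real.tendsto_pow_mul_exp_neg_atTop_nhds_zero 1
      rw [mul_zero, add_zero] at h2
      refine (h2.comp tendsto_neg_atBot_atTop).congr' ?_
      filter_upwards [eventually_le_atBot (0 : ℝ)] with r hr
      simp only [Function.comp, neg_neg, abs_of_nonpos hr]
      ring
    refine squeeze_zero_norm' ?_ (h1.comp hre)
    filter_upwards [eventually_im_stripFilter atBot] with w hw
    rw [norm_mul, Complex.norm_exp]
    exact mul_le_mul_of_nonneg_right ((Complex.norm_le_abs_re_add_abs_im w).trans
      (by simpa using hw)) (Real.exp_pos _).le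
  have hlim : Tendsto (fun w : ℂ =>
      ((Complex.exp w - 1) ^ 2 / (w * Complex.exp w - Complex.exp w + 1) - stripKernel a) /
        (Complex.exp a - Complex.exp w)) (stripFilter atBot)
      (𝓝 (((0 - 1) ^ 2 / (0 - 0 + 1) - stripKernel a) / (Complex.exp a - 0))) := by
    refine Tendsto.div (Tendsto.sub (Tendsto.div ?_ ?_ (by norm_num)) tendsto_const_nhds)
      (tendsto_const_nhds.sub he) (by simp)
    · exact (he.sub tendsto_const_nhds).pow 2
    · exact (hm.sub he).add tendsto_const_nhds
  have hlim' : Tendsto (fun w : ℂ =>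
      ((Complex.exp w - 1) ^ 2 / (w * Complex.exp w - Complex.exp w + 1) - stripKernel a) /
        (Complex.exp a - Complex.exp w)) (stripFilter atBot)
      (𝓝 ((1 - stripKernel a) / Complex.exp a)) := by
    convert hlim using 2
    norm_num
  refine hlim'.congr' ?_
  filter_upwards [hre.eventually_lt_atBot (min a 0)] with w hw
  have hwa : w ≠ a := by
    rintro rfl
    have := hw.trans_le (min_le_left a 0)
    simp at this
  have hw0 : w ≠ 0 := by
    rintro rfl
    have := hw.trans_le (min_le_right a 0)
    simp at this
  rw [stripIntegrand_of_ne hwa, stripKernel_of_ne_zero hw0]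

/-- Integrals over vertical segments of the strip follow the limit of the integrand. -/
lemma tendsto_verticalIntegral {f : ℂ → ℂ} {l : Filter ℝ} {r : ℝ → ℝ} {c : ℂ}
    (hf : ∀ w : ℂ, |w.im| ≤ Real.pi → ContinuousAt f w)
    (hlim : Tendsto f (stripFilter l) (𝓝 c)) (hr : Tendsto r atTop l) :
    Tendsto (fun R => ∫ y in (-Real.pi)..Real.pi, f (r R + y * Complex.I)) atTop
      (𝓝 (2 * Real.pi * c)) := by
  have hpi := Real.pi_pos
  rw [Metric.tendsto_nhds]
  intro ε hε
  have h1 : ∀ᶠ w in stripFilter l, ‖f w - c‖ < ε / (4 * Real.pi) := by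
    have := (Metric.tendsto_nhds.1 hlim) (ε / (4 * Real.pi)) (by positivity)
    simpa [dist_eq_norm] using this
  rw [stripFilter, eventually_inf_principal, eventually_comap] at h1
  filter_upwards [hr.eventually h1] with R hR
  have hint : IntervalIntegrable (fun y : ℝ => f (r R + y * Complex.I)) volume
      (-Real.pi) Real.pi := by
    apply ContinuousOn.intervalIntegrable
    intro y hy
    rw [uIcc_of_le (by linarith)] at hy
    have : ContinuousAt (fun y : ℝ => f (r R + y * Complex.I)) y := by
      refine ContinuousAt.comp (g := f) ?_ (by fun_prop)
      apply hf
      simpa using abs_le.2 hy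
    exact this.continuousWithinAt
  have heq : (∫ y in (-Real.pi)..Real.pi, f (r R + y * Complex.I)) - 2 * Real.pi * c =
      ∫ y in (-Real.pi)..Real.pi, (f (r R + y * Complex.I) - c) := by
    rw [intervalIntegral.integral_sub hint (by simp), intervalIntegral.integral_const,
      Complex.real_smul]
    push_cast
    ring
  rw [dist_eq_norm, heq]
  have := intervalIntegral.norm_integral_le_of_norm_le_const (a := -Real.pi) (b := Real.pi)
    (f := fun y : ℝ => f (r R + y * Complex.I) - c) (C := ε / (4 * Real.pi)) (by
      intro y hy
      rw [uIoc_of_le (by linarith)] at hy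
      refine (hR _ (by simp) ?_).le
      simpa using abs_le.2 ⟨hy.1.le, hy.2⟩)
  rw [abs_of_pos (by linarith)] at this
  have h4 : ε / (4 * Real.pi) * (Real.pi - -Real.pi) = ε / 2 := by field_simp; ring
  linarith

/-- The jump of the integrand across the strip, up to the factor `-2πi`. -/
noncomputable def jumpDensity (a u : ℝ) : ℝ :=
  (Real.exp u + 1) ^ 2 * Real.exp u /
    (((1 + Real.exp u - u * Real.exp u) ^ 2 + Real.pi ^ 2 * Real.exp u ^ 2) *
      (Real.exp a + Real.exp u))

lemma jump_denom_pos (u : ℝ) :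
    0 < (1 + Real.exp u - u * Real.exp u) ^ 2 + Real.pi ^ 2 * Real.exp u ^ 2 := by
  have := Real.exp_pos u
  have := Real.pi_pos
  positivity

lemma jumpDensity_nonneg (a u : ℝ) : 0 ≤ jumpDensity a u := by
  have := jump_denom_pos u
  unfold jumpDensity
  positivity

lemma continuous_jumpDensity (a : ℝ) : Continuous (jumpDensity a) := by
  unfold jumpDensity
  refine Continuous.div (by fun_prop) (by fun_prop) ?_
  intro u
  have := jump_denom_pos u
  positivity

lemma stripIntegrand_sub (a u : ℝ) :
    stripIntegrand a (u + (-Real.pi : ℝ) * Complex.I) - stripIntegrand a (u + Real.pi * Complex.I)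
      = -(2 * Real.pi * Complex.I) * (jumpDensity a u : ℝ) := by
  have hpi := Real.pi_pos
  have hne : ∀ b : ℝ, |b| = Real.pi → ∀ c : ℝ, (u + b * Complex.I : ℂ) ≠ c := by
    intro b hb c h
    have := congrArg Complex.im h
    simp at this
    rw [this] at hb; simp at hb; linarith
  have hexp : ∀ b : ℝ, (b = Real.pi ∨ b = -Real.pi) →
      Complex.exp (u + b * Complex.I) = -(Real.exp u : ℝ) := by
    rintro b (rfl | rfl)
    · rw [Complex.exp_add, Complex.exp_pi_mul_I]; simp
    · rw [Complex.exp_add]; push_cast; rw [neg_mul, Complex.exp_neg, Complex.exp_pi_mul_I]; simp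
  have hform : ∀ b : ℝ, (b = Real.pi ∨ b = -Real.pi) →
      stripIntegrand a (u + b * Complex.I) =
        ((Real.exp u + 1) ^ 2 / ((1 + Real.exp u - u * Real.exp u) - b * Real.exp u * Complex.I)
          - stripKernel a) / (Real.exp a + Real.exp u) := by
    intro b hb
    have hb' : |b| = Real.pi := by
      rcases hb with rfl | rfl
      · exact abs_of_pos hpi
      · rw [abs_neg, abs_of_pos hpi]
    rw [stripIntegrand_of_ne (hne b hb' a), stripKernel_of_ne_zero (by simpa using hne b hb' 0),
      hexp b hb]
    push_cast
    congr 3 <;> ring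
  have hden : ∀ b : ℝ, (b = Real.pi ∨ b = -Real.pi) →
      ((1 + Real.exp u - u * Real.exp u) - b * Real.exp u * Complex.I : ℂ) ≠ 0 := by
    intro b hb h
    have := congrArg Complex.im h
    simp [-Complex.ofReal_exp] at this
    rcases hb with rfl | rfl
    · linarith
    · linarith
  rw [hform _ (Or.inr rfl), hform _ (Or.inl rfl)]
  have h1 := hden _ (Or.inl rfl)
  have h2 := hden _ (Or.inr rfl)
  have h3 : ((Real.exp a : ℂ) + Real.exp u) ≠ 0 := by
    have : 0 < Real.exp a + Real.exp u := by positivity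
    exact_mod_cast this.ne'
  have h5 : (((1 + Real.exp u - u * Real.exp u) ^ 2 + Real.pi ^ 2 * Real.exp u ^ 2 : ℂ)) =
      ((1 + Real.exp u - u * Real.exp u) - (Real.pi : ℝ) * Real.exp u * Complex.I) *
      ((1 + Real.exp u - u * Real.exp u) - (-Real.pi : ℝ) * Real.exp u * Complex.I) := by
    push_cast
    linear_combination ((Real.pi : ℂ) ^ 2 * Complex.exp u ^ 2) * Complex.I_sq
  rw [jumpDensity, Complex.ofReal_div, Complex.ofReal_mul, Complex.ofReal_mul]
  push_cast at h1 h2 h3 h5 ⊢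
  rw [h5]
  have halg : ∀ {N k T D₁ D₂ e P : ℂ}, T ≠ 0 → D₁ ≠ 0 → D₂ ≠ 0 → D₂ - D₁ = -P * e →
      (N / D₁ - k) / T - (N / D₂ - k) / T = -P * (N * e / (D₂ * D₁ * T)) := by
    intro N k T D₁ D₂ e P hT h₁ h₂ h
    field_simp
    linear_combination N * h
  exact halg h3 h2 h1 (by ring)

/-- The residue computation for the strip. -/
lemma tendsto_integral_jumpDensity (a : ℝ) :
    Tendsto (fun R : ℝ => ((∫ u in (-R)..R, jumpDensity a u : ℝ) : ℂ)) atTop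
      (𝓝 ((stripKernel a - 1) / Complex.exp a)) := by
  have hpi := Real.pi_pos
  have hc : ∀ w : ℂ, |w.im| ≤ Real.pi → ContinuousAt (stripIntegrand a) w := fun w hw =>
    (differentiableAt_stripIntegrand a hw).continuousAt
  have hright := tendsto_verticalIntegral hc (tendsto_stripIntegrand_right a) tendsto_id
  have hleft := tendsto_verticalIntegral hc (tendsto_stripIntegrand_left a)
    tendsto_neg_atTop_atBot
  have hlim := (hright.sub hleft).const_mul (1 / (2 * Real.pi : ℂ))
  have hpc : (Real.pi : ℂ) ≠ 0 := by exact_mod_cast hpi.ne'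
  have hval : 1 / (2 * Real.pi : ℂ) *
      (2 * Real.pi * 0 - 2 * Real.pi * ((1 - stripKernel a) / Complex.exp a)) =
      (stripKernel a - 1) / Complex.exp a := by
    field_simp
    ring
  rw [hval] at hlim
  refine hlim.congr ?_
  intro R
  have hhor : ∀ b : ℝ, |b| ≤ Real.pi → IntervalIntegrable
      (fun x : ℝ => stripIntegrand a (x + b * Complex.I)) volume (-R) R := by
    intro b hb
    apply Continuous.intervalIntegrable
    rw [continuous_iff_continuousAt]
    intro x
    refine ContinuousAt.comp (g := stripIntegrand a) ?_ (by fun_prop)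
    apply hc
    simpa using hb
  have hrect := Complex.integral_boundary_rect_eq_zero_of_differentiableOn (stripIntegrand a)
    (⟨-R, -Real.pi⟩ : ℂ) (⟨R, Real.pi⟩ : ℂ) (by
      intro w hw
      refine (differentiableAt_stripIntegrand a ?_).differentiableWithinAt
      have := hw.2
      simp only [mem_preimage] at this
      rw [uIcc_of_le (by linarith)] at this
      exact abs_le.2 this)
  simp only at hrect
  rw [← intervalIntegral.integral_sub (hhor _ (by rw [abs_neg, abs_of_pos hpi]))
    (hhor _ (abs_of_pos hpi).le)] at hrect
  simp only [stripIntegrand_sub] at hrect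
  rw [intervalIntegral.integral_const_mul, intervalIntegral.integral_ofReal] at hrect
  simp only [smul_eq_mul] at hrect
  simp only [id]
  have hI := Complex.I_ne_zero
  generalize (∫ y in (-Real.pi)..Real.pi, stripIntegrand a ((R : ℂ) + y * Complex.I)) = A
    at hrect ⊢
  generalize (∫ y in (-Real.pi)..Real.pi, stripIntegrand a (((-R : ℝ) : ℂ) + y * Complex.I)) = B
    at hrect ⊢
  rw [one_div, inv_mul_eq_iff_eq_mul₀ (mul_ne_zero two_ne_zero hpc)]
  apply mul_left_cancel₀ hI
  linear_combination hrect

lemma integrable_jumpDensity_and_integral {a κ : ℝ} (hκ : stripKernel a = κ) :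
    Integrable (jumpDensity a) ∧ ∫ u, jumpDensity a u = (κ - 1) / Real.exp a := by
  have h := tendsto_integral_jumpDensity a
  rw [hκ] at h
  have h' : Tendsto (fun R : ℝ => ∫ u in (-R)..R, jumpDensity a u) atTop
      (𝓝 ((κ - 1) / Real.exp a)) := by
    have := (Complex.continuous_re.tendsto _).comp h
    have hre : ((κ - 1 : ℂ) / Complex.exp a).re = (κ - 1) / Real.exp a := by
      have : ((κ - 1 : ℂ) / Complex.exp a) = (((κ - 1) / Real.exp a : ℝ) : ℂ) := by push_cast; rfl
      rw [this, Complex.ofReal_re]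
    rw [hre] at this
    exact this
  have hint : Integrable (jumpDensity a) := by
    refine integrable_of_intervalIntegral_norm_tendsto ((κ - 1) / Real.exp a)
      (a := fun R : ℝ => -R) (b := id) (l := atTop) ?_ tendsto_neg_atTop_atBot tendsto_id ?_
    · intro R
      exact (continuous_jumpDensity a).integrableOn_Icc.mono_set Ioc_subset_Icc_self
    · simpa only [Real.norm_of_nonneg (jumpDensity_nonneg a _), id] using h'
  exact ⟨hint, tendsto_nhds_unique
    (intervalIntegral_tendsto_integral hint tendsto_neg_atTop_atBot tendsto_id) h'⟩

end Contour

section Laplace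

/-- The integral `∫_0^∞ t^n e^{-xt} φ(t) dt`. -/
noncomputable def laplaceMoment (φ : ℝ → ℝ) (n : ℕ) (x : ℝ) : ℝ :=
  ∫ t in Ioi (0 : ℝ), t ^ n * Real.exp (-(x * t)) * φ t

lemma integrableOn_pow_mul_exp_neg (n : ℕ) {x : ℝ} (hx : 0 < x) :
    IntegrableOn (fun t : ℝ => t ^ n * Real.exp (-(x * t))) (Ioi 0) := by
  have := integrableOn_rpow_mul_exp_neg_mul_rpow (p := 1) (s := n) (b := x)
    (by have : (0 : ℝ) ≤ n := n.cast_nonneg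
        linarith) one_pos hx
  simpa using this

variable {φ : ℝ → ℝ} {M : ℝ}

lemma integrableOn_laplaceMoment (hφ : ContinuousOn φ (Ioi 0)) (hM : ∀ t ∈ Ioi (0 : ℝ), |φ t| ≤ M)
    (n : ℕ) {x : ℝ} (hx : 0 < x) :
    IntegrableOn (fun t : ℝ => t ^ n * Real.exp (-(x * t)) * φ t) (Ioi 0) :=
  (integrableOn_pow_mul_exp_neg n hx).mul_bdd (c := M)
    (hφ.aestronglyMeasurable measurableSet_Ioi)
    ((ae_restrict_mem measurableSet_Ioi).mono hM)

lemma hasDerivAt_laplaceMoment (hφ : ContinuousOn φ (Ioi 0))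
    (hM : ∀ t ∈ Ioi (0 : ℝ), |φ t| ≤ M) (n : ℕ) {x : ℝ} (hx : 0 < x) :
    HasDerivAt (laplaceMoment φ n) (-laplaceMoment φ (n + 1) x) x := by
  have h := hasDerivAt_integral_of_dominated_loc_of_deriv_le
    (μ := volume.restrict (Ioi (0 : ℝ))) (x₀ := x) (s := Ioi (x / 2))
    (F := fun x t => t ^ n * Real.exp (-(x * t)) * φ t)
    (F' := fun x t => -(t ^ (n + 1) * Real.exp (-(x * t)) * φ t))
    (bound := fun t => t ^ (n + 1) * Real.exp (-(x / 2 * t)) * M)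
    (Ioi_mem_nhds (by linarith))
    ((lt_mem_nhds hx).mono fun y hy => (integrableOn_laplaceMoment hφ hM n hy).1)
    (integrableOn_laplaceMoment hφ hM n hx)
    (integrableOn_laplaceMoment hφ hM (n + 1) hx).neg.1
    (by
      filter_upwards [ae_restrict_mem measurableSet_Ioi] with t ht y hy
      have ht' : 0 < t := ht
      have hy' : x / 2 < y := hy
      rw [norm_neg, norm_mul, Real.norm_eq_abs, Real.norm_eq_abs, abs_of_pos (by positivity)]
      have := hM t ht
      gcongr)
    ((integrableOn_pow_mul_exp_neg (n + 1) (by linarith : 0 < x / 2)).mul_const M)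
    (by
      filter_upwards with t y _
      have h1 : HasDerivAt (fun y : ℝ => -(y * t)) (-(1 * t)) y :=
        ((hasDerivAt_id y).mul_const t).neg
      have h2 := ((h1.exp.const_mul (t ^ n)).mul_const (φ t))
      exact h2.congr_deriv (by ring))
  have h' := h.2
  rw [integral_neg] at h'
  exact h'

lemma iteratedDerivWithin_laplaceMoment (hφ : ContinuousOn φ (Ioi 0))
    (hM : ∀ t ∈ Ioi (0 : ℝ), |φ t| ≤ M) (n : ℕ) :
    EqOn (iteratedDerivWithin n (laplaceMoment φ 0) (Ioi 0))
      (fun x => (-1) ^ n * laplaceMoment φ n x) (Ioi 0) := by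
  induction n with
  | zero => intro x _; simp
  | succ n ih =>
    intro x hx
    rw [iteratedDerivWithin_succ, derivWithin_congr ih (ih hx),
      derivWithin_of_isOpen isOpen_Ioi hx,
      ((hasDerivAt_laplaceMoment hφ hM n hx).const_mul _).deriv]
    ring

lemma contDiffOn_laplaceMoment (hφ : ContinuousOn φ (Ioi 0))
    (hM : ∀ t ∈ Ioi (0 : ℝ), |φ t| ≤ M) :
    ContDiffOn ℝ (⊤ : ℕ∞) (laplaceMoment φ 0) (Ioi 0) := by
  refine contDiffOn_of_differentiableOn_deriv fun m _ => ?_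
  refine DifferentiableOn.congr (fun x hx => ?_) (iteratedDerivWithin_laplaceMoment hφ hM m)
  exact ((hasDerivAt_laplaceMoment hφ hM m hx).const_mul _).differentiableAt.differentiableWithinAt

/-- Away from its maximum at `1`, the function `y e^{1-y}` stays away from `1`. -/
lemma mul_exp_one_sub_le {δ : ℝ} (hδ : 0 < δ) {y : ℝ} (hy : 0 < y) (hyδ : δ ≤ |y - 1|) :
    y * Real.exp (1 - y) ≤ 1 / (1 + δ ^ 2 / (4 * (1 + δ))) := by
  have h1 : (1 + (y - 1) / 2) ^ 2 ≤ Real.exp (y - 1) := by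
    have h2 := Real.add_one_le_exp ((y - 1) / 2)
    have h3 : Real.exp (y - 1) = Real.exp ((y - 1) / 2) ^ 2 := by
      rw [← Real.exp_nat_mul]; congr 1; push_cast; ring
    rw [h3]
    have : 0 ≤ 1 + (y - 1) / 2 := by linarith
    gcongr
    linarith
  have h4 : δ ^ 2 * y ≤ (y - 1) ^ 2 * (1 + δ) := by
    have : 0 ≤ (y - 1 - δ) * (y - 1 + δ + (y - 1) * δ) := by
      rcases le_abs.1 hyδ with h | h
      · have : 0 ≤ (y - 1) * δ := by nlinarith
        exact mul_nonneg (by linarith) (by linarith)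
      · have : (y - 1) * δ ≤ 0 := by nlinarith
        exact mul_nonneg_of_nonpos_of_nonpos (by linarith) (by linarith)
    nlinarith
  have h5 : δ ^ 2 / (4 * (1 + δ)) * y ≤ (y - 1) ^ 2 / 4 := by
    rw [div_mul_eq_mul_div, div_le_iff₀ (by positivity)]
    linarith
  rw [le_div_iff₀ (by positivity), ← neg_sub y 1, Real.exp_neg, mul_right_comm,
    mul_inv_le_iff₀ (Real.exp_pos _)]
  linarith

/-- A bounded continuous function with nonnegative Laplace moments is nonnegative. -/
lemma nonneg_of_laplaceMoment_nonneg (hφ : ContinuousOn φ (Ioi 0))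
    (hM : ∀ t ∈ Ioi (0 : ℝ), |φ t| ≤ M)
    (hpos : ∀ n : ℕ, ∀ x ∈ Ioi (0 : ℝ), 0 ≤ laplaceMoment φ n x) {t₀ : ℝ} (ht₀ : 0 < t₀) :
    0 ≤ φ t₀ := by
  by_contra! hneg
  have hM0 : 0 ≤ M := (abs_nonneg _).trans (hM t₀ ht₀)
  obtain ⟨δ, hδ, hφδ⟩ : ∃ δ > 0, ∀ t ∈ Ioi (0 : ℝ), |t / t₀ - 1| < δ → φ t < φ t₀ / 2 := by
    have h1 : ∀ᶠ t in 𝓝 t₀, φ t < φ t₀ / 2 :=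
      (hφ.continuousAt (Ioi_mem_nhds ht₀)).eventually_lt continuousAt_const (by linarith)
    obtain ⟨ε, hε, h2⟩ := Metric.eventually_nhds_iff.1 h1
    refine ⟨ε / t₀, by positivity, fun t _ ht => h2 ?_⟩
    rw [Real.dist_eq]
    have : t / t₀ - 1 = (t - t₀) / t₀ := by field_simp
    rwa [this, abs_div, abs_of_pos ht₀, div_lt_div_iff_of_pos_right ht₀] at ht
  set c : ℝ → ℝ := fun t => t / t₀ * Real.exp (1 - t / t₀) with hc
  have hcc : Continuous c := by fun_prop
  set q' : ℝ := 1 / (1 + δ ^ 2 / (4 * (1 + δ)))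
  have hq'0 : 0 < q' := by positivity
  have hq'1 : q' < 1 := by
    rw [div_lt_one (by positivity)]
    have : 0 < δ ^ 2 / (4 * (1 + δ)) := by positivity
    linarith
  obtain ⟨q, hq', hq1⟩ := exists_between hq'1
  have hq0 : 0 < q := hq'0.trans hq'
  obtain ⟨r, hr, hcr⟩ : ∃ r > 0, ∀ t, |t - t₀| < r → 0 < t ∧ q < c t := by
    have h1 : ∀ᶠ t in 𝓝 t₀, 0 < t ∧ q < c t := by
      refine (lt_mem_nhds ht₀).and (hcc.continuousAt.eventually (lt_mem_nhds ?_))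
      simpa [hc, ht₀.ne'] using hq1
    obtain ⟨ε, hε, h2⟩ := Metric.eventually_nhds_iff.1 h1
    exact ⟨ε, hε, fun t ht => h2 (by rwa [Real.dist_eq])⟩
  set I : Set ℝ := Ioo (t₀ - r) (t₀ + r)
  have hI : ∀ t ∈ I, |t - t₀| < r := fun t ht => abs_lt.2 ⟨by linarith [ht.1], by linarith [ht.2]⟩
  have hcint : IntegrableOn c (Ioi 0) := by
    have := ((integrableOn_pow_mul_exp_neg 1 (x := 1 / t₀) (by positivity)).const_mul
      (Real.exp 1 / t₀))
    refine this.congr (ae_of_all _ fun t => ?_)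
    simp only [hc]
    rw [sub_eq_add_neg, Real.exp_add]
    have : 1 / t₀ * t = t / t₀ := by ring
    rw [this]; ring
  have hcpow : ∀ n : ℕ, ∀ t, c t ^ n = (Real.exp 1 / t₀) ^ n *
      (t ^ n * Real.exp (-(n / t₀ * t))) := by
    intro n t
    simp only [hc]
    rw [sub_eq_add_neg, Real.exp_add, mul_pow, mul_pow, ← Real.exp_nat_mul _ n,
      ← Real.exp_nat_mul (-(t / t₀)) n, div_pow, div_pow, ← Real.exp_nat_mul]
    have : (n : ℝ) * -(t / t₀) = -(n / t₀ * t) := by ring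
    rw [this]; ring
  have hineq : ∀ n : ℕ, 0 ≤ φ t₀ / 2 * (2 * r) +
      (q' / q) ^ n * (M / q * ∫ t in Ioi (0 : ℝ), c t) := by
    intro n
    have hpt : ∀ t ∈ Ioi (0 : ℝ), (c t / q) ^ (n + 1) * φ t ≤
        I.indicator (fun _ => φ t₀ / 2) t + (q' / q) ^ n * (M / q * c t) := by
      intro t ht
      have ht' : 0 < t := ht
      have hct : 0 < c t := by simp only [hc]; positivity
      have hrest : 0 ≤ (q' / q) ^ n * (M / q * c t) := by positivity
      by_cases hnear : |t / t₀ - 1| < δ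
      · have hφt := hφδ t ht hnear
        by_cases htI : t ∈ I
        · rw [indicator_of_mem htI]
          have h1 : 1 ≤ (c t / q) ^ (n + 1) :=
            one_le_pow₀ ((one_le_div hq0).2 (hcr t (hI t htI)).2.le)
          nlinarith
        · rw [indicator_of_notMem htI]
          have h1 : 0 < (c t / q) ^ (n + 1) := by positivity
          nlinarith
      · have hle : c t ≤ q' := mul_exp_one_sub_le hδ (by positivity) (not_lt.1 hnear)
        have htI : t ∉ I := fun h => absurd (hcr t (hI t h)).2 (by linarith)
        rw [indicator_of_notMem htI, zero_add]
        calc (c t / q) ^ (n + 1) * φ t ≤ (c t / q) ^ (n + 1) * M := by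
              gcongr
              exact (le_abs_self _).trans (hM t ht)
          _ = (c t / q) ^ n * (M / q * c t) := by ring
          _ ≤ _ := by gcongr
    have hlhs : ∀ t, (c t / q) ^ (n + 1) * φ t = (Real.exp 1 / t₀ / q) ^ (n + 1) *
        (t ^ (n + 1) * Real.exp (-((n + 1 : ℕ) / t₀ * t)) * φ t) := by
      intro t
      rw [div_pow, hcpow, div_pow _ q]; ring
    have hx : (0 : ℝ) < (n + 1 : ℕ) / t₀ := by positivity
    have hint1 : IntegrableOn (fun t => (c t / q) ^ (n + 1) * φ t) (Ioi 0) := by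
      simp only [hlhs]
      exact (integrableOn_laplaceMoment hφ hM (n + 1) hx).const_mul _
    have hint2 : IntegrableOn (I.indicator (fun _ => φ t₀ / 2)) (Ioi 0) := by
      refine Integrable.integrableOn ?_
      rw [integrable_indicator_iff measurableSet_Ioo]
      exact integrableOn_const (by simp)
    have hint3 : IntegrableOn (fun t => (q' / q) ^ n * (M / q * c t)) (Ioi 0) :=
      (hcint.const_mul _).const_mul _
    have hmono := setIntegral_mono_on hint1 (hint2.add hint3) measurableSet_Ioi hpt
    have hnn : 0 ≤ ∫ t in Ioi (0 : ℝ), (c t / q) ^ (n + 1) * φ t := by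
      simp only [hlhs]
      rw [integral_const_mul]
      exact mul_nonneg (by positivity) (hpos (n + 1) _ hx)
    have hIsub : I ⊆ Ioi 0 := fun t ht => (hcr t (hI t ht)).1
    have hval : ∫ t in Ioi (0 : ℝ), I.indicator (fun _ => φ t₀ / 2) t = φ t₀ / 2 * (2 * r) := by
      rw [setIntegral_indicator measurableSet_Ioo, inter_eq_right.2 hIsub, setIntegral_const,
        measureReal_def, Real.volume_Ioo, ENNReal.toReal_ofReal (by linarith), smul_eq_mul]
      ring
    simp only [Pi.add_apply] at hmono
    rw [integral_add hint2 hint3, hval, integral_const_mul, integral_const_mul] at hmono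
    exact hnn.trans hmono
  have hlim : Tendsto (fun n : ℕ => φ t₀ / 2 * (2 * r) +
      (q' / q) ^ n * (M / q * ∫ t in Ioi (0 : ℝ), c t)) atTop
      (𝓝 (φ t₀ / 2 * (2 * r) + 0 * (M / q * ∫ t in Ioi (0 : ℝ), c t))) :=
    tendsto_const_nhds.add ((tendsto_pow_atTop_nhds_zero_of_lt_one (by positivity)
      ((div_lt_one hq0).2 hq')).mul_const _)
  have := ge_of_tendsto' hlim hineq
  nlinarith

/-- The Laplace transform of a bounded continuous function is completely monotonic if and only
if the function is nonnegative. -/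
lemma completelyMonotonicOn_laplaceMoment_iff (hφ : ContinuousOn φ (Ioi 0))
    (hM : ∀ t ∈ Ioi (0 : ℝ), |φ t| ≤ M) :
    CompletelyMonotonicOn (laplaceMoment φ 0) ↔ ∀ t : ℝ, 0 < t → 0 ≤ φ t := by
  have hsign : ∀ (n : ℕ), ∀ x ∈ Ioi (0 : ℝ),
      (-1 : ℝ) ^ n * iteratedDerivWithin n (laplaceMoment φ 0) (Ioi 0) x =
        laplaceMoment φ n x := by
    intro n x hx
    rw [iteratedDerivWithin_laplaceMoment hφ hM n hx, ← mul_assoc, ← mul_pow]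
    simp
  constructor
  · rintro ⟨-, h⟩ t ht
    exact nonneg_of_laplaceMoment_nonneg hφ hM (fun n x hx => hsign n x hx ▸ h n x hx) ht
  · intro h
    refine ⟨contDiffOn_laplaceMoment hφ hM, fun n x hx => ?_⟩
    rw [hsign n x hx]
    refine setIntegral_nonneg measurableSet_Ioi fun t ht => ?_
    have ht' : 0 < t := ht
    have := h t ht'
    positivity

end Laplace

section Density

lemma sigmoid_eq_exp_div (u : ℝ) : Real.sigmoid u = Real.exp u / (1 + Real.exp u) := by
  rw [Real.sigmoid_def, Real.exp_neg]
  have := Real.exp_pos u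
  field_simp
  ring

lemma sigmoid_deriv_mul_tau0 (u : ℝ) :
    |Real.sigmoid u * (1 - Real.sigmoid u)| * tau0 (1 - Real.sigmoid u) = jumpDensity 0 u := by
  have he := Real.exp_pos u
  have hs := Real.sigmoid_pos u
  have hs1 := Real.sigmoid_lt_one u
  rw [abs_of_pos (mul_pos hs (by linarith)), tau0, jumpDensity, Real.exp_zero]
  have hlog : Real.log ((1 - (1 - Real.sigmoid u)) / (1 - Real.sigmoid u)) = u := by
    rw [sigmoid_eq_exp_div]
    have : (1 - (1 - Real.exp u / (1 + Real.exp u))) / (1 - Real.exp u / (1 + Real.exp u)) =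
        Real.exp u := by field_simp; ring
    rw [this, Real.log_exp]
  rw [hlog, sigmoid_eq_exp_div]
  set e := Real.exp u
  have h1 : 1 - e / (1 + e) = 1 / (1 + e) := by field_simp; ring
  have h2 : 1 - 1 / (1 + e) = e / (1 + e) := by field_simp; ring
  rw [h1, h2]
  have h3 : 1 / (1 + e) * (e / (1 + e) * u - 1) ^ 2 + Real.pi ^ 2 * (1 / (1 + e)) *
      (e / (1 + e)) ^ 2 = ((1 + e - u * e) ^ 2 + Real.pi ^ 2 * e ^ 2) / (1 + e) ^ 3 := by
    field_simp
    ring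
  rw [h3]
  have := jump_denom_pos u
  field_simp
  ring

lemma jumpDensity_eq_mul (u : ℝ) {a x : ℝ} (hx : 0 < x) (hax : Real.exp a * x = x + 1) :
    jumpDensity 0 u * (1 / (x + 1 - Real.sigmoid u)) = jumpDensity a u / x := by
  have he := Real.exp_pos u
  have ha := Real.exp_pos a
  have hd := jump_denom_pos u
  have h1 : x + 1 - Real.sigmoid u = x * (Real.exp a + Real.exp u) / (1 + Real.exp u) := by
    rw [sigmoid_eq_exp_div]
    field_simp
    linear_combination -hax
  rw [h1, jumpDensity, jumpDensity, Real.exp_zero]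
  field_simp

lemma image_sigmoid : Real.sigmoid '' univ = Ioo 0 1 := by
  rw [image_univ, Real.range_sigmoid]

lemma integrableOn_Ioo_iff_sigmoid (g : ℝ → ℝ) :
    IntegrableOn g (Ioo 0 1) ↔
      Integrable (fun u => |Real.sigmoid u * (1 - Real.sigmoid u)| * g (Real.sigmoid u)) := by
  rw [← image_sigmoid, integrableOn_image_iff_integrableOn_abs_deriv_smul MeasurableSet.univ
    (fun u _ => (Real.hasDerivAt_sigmoid u).hasDerivWithinAt)
    Real.sigmoid_injective.injOn g, integrableOn_univ]
  rfl

lemma integral_Ioo_eq_sigmoid (g : ℝ → ℝ) :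
    ∫ s in Ioo (0 : ℝ) 1, g s =
      ∫ u, |Real.sigmoid u * (1 - Real.sigmoid u)| * g (Real.sigmoid u) := by
  rw [← image_sigmoid, integral_image_eq_integral_abs_deriv_smul MeasurableSet.univ
    (fun u _ => (Real.hasDerivAt_sigmoid u).hasDerivWithinAt)
    Real.sigmoid_injective.injOn g, setIntegral_univ]
  rfl

lemma integrableOn_tau0 : IntegrableOn (fun s => tau0 (1 - s)) (Ioo 0 1) := by
  rw [integrableOn_Ioo_iff_sigmoid]
  simp only [sigmoid_deriv_mul_tau0]
  exact (integrable_jumpDensity_and_integral (κ := 2) (by simpa using stripKernel_zero)).1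

lemma integral_tau0 : ∫ s in Ioo (0 : ℝ) 1, tau0 (1 - s) = 1 := by
  rw [integral_Ioo_eq_sigmoid]
  simp only [sigmoid_deriv_mul_tau0]
  rw [(integrable_jumpDensity_and_integral (κ := 2) (by simpa using stripKernel_zero)).2]
  norm_num

/-- The Stieltjes representation of `-g'' / g'`, where `g x = x log (1 + 1 / x)`. -/
lemma integral_tau0_div {x : ℝ} (hx : 0 < x) :
    ∫ s in Ioo (0 : ℝ) 1, tau0 (1 - s) * (1 / (x + 1 - s)) =
      1 / (x * (x + 1) * ((x + 1) * Real.log (1 + 1 / x) - 1)) - 1 / (x + 1) := by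
  have hx1 : 0 < 1 + 1 / x := by positivity
  have hgt : 1 < 1 + 1 / x := by
    have : 0 < 1 / x := by positivity
    linarith
  set a := Real.log (1 + 1 / x) with ha
  have ha0 : a ≠ 0 := (Real.log_pos hgt).ne'
  have hea : Real.exp a = 1 + 1 / x := Real.exp_log hx1
  have hax : Real.exp a * x = x + 1 := by rw [hea]; field_simp
  have hκ : stripKernel a =
      (((Real.exp a - 1) ^ 2 / (a * Real.exp a - Real.exp a + 1) : ℝ) : ℂ) := by
    rw [stripKernel_of_ne_zero (by exact_mod_cast ha0)]
    push_cast; rfl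
  rw [integral_Ioo_eq_sigmoid]
  simp only [← mul_assoc, sigmoid_deriv_mul_tau0, jumpDensity_eq_mul _ hx hax]
  rw [integral_div, (integrable_jumpDensity_and_integral hκ).2, hea]
  have hne : (x + 1) * a - 1 ≠ 0 := by
    have h := Real.add_one_lt_exp (x := -a) (neg_ne_zero.2 ha0)
    rw [Real.exp_neg, hea] at h
    have h2 : (1 + 1 / x)⁻¹ = x / (x + 1) := by field_simp
    rw [h2, lt_div_iff₀ (by linarith)] at h
    intro h0
    nlinarith
  have h3 : a * (1 + 1 / x) - (1 + 1 / x) + 1 = ((x + 1) * a - 1) / x := by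
    field_simp; ring
  rw [h3]
  field_simp
  ring

end Density

section Mixture

/-- The function `c e^{-t} + ∫_0^1 e^{-t(1-s)} η(s) ds`. -/
noncomputable def expMixture (c : ℝ) (η : ℝ → ℝ) (t : ℝ) : ℝ :=
  c * Real.exp (-t) + ∫ s in Ioo (0 : ℝ) 1, Real.exp (-(t * (1 - s))) * η s

variable {c : ℝ} {η : ℝ → ℝ}

lemma aestronglyMeasurable_exp_mul (hη : IntegrableOn η (Ioo 0 1)) (t : ℝ) :
    AEStronglyMeasurable (fun s => Real.exp (-(t * (1 - s))) * η s)
      (volume.restrict (Ioo 0 1)) :=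
  (Continuous.aestronglyMeasurable (by fun_prop)).mul hη.1

lemma norm_exp_mul_le {t s : ℝ} (ht : 0 < t) (hs : s ∈ Ioo (0 : ℝ) 1) :
    ‖Real.exp (-(t * (1 - s))) * η s‖ ≤ ‖η s‖ := by
  rw [norm_mul, Real.norm_of_nonneg (Real.exp_pos _).le]
  refine mul_le_of_le_one_left (norm_nonneg _) (Real.exp_le_one_iff.2 ?_)
  have : 0 < 1 - s := by linarith [hs.2]
  have := mul_pos ht this
  linarith

lemma continuousOn_expMixture (hη : IntegrableOn η (Ioo 0 1)) :
    ContinuousOn (expMixture c η) (Ioi 0) := by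
  refine ContinuousOn.add (by fun_prop) ?_
  refine continuousOn_of_dominated (bound := fun s => ‖η s‖)
    (fun t _ => aestronglyMeasurable_exp_mul hη t) (fun t ht => ?_) hη.norm ?_
  · filter_upwards [ae_restrict_mem measurableSet_Ioo] with s hs using norm_exp_mul_le ht hs
  · exact ae_of_all _ fun s => by fun_prop

lemma abs_expMixture_le (hη : IntegrableOn η (Ioo 0 1)) {t : ℝ} (ht : t ∈ Ioi (0 : ℝ)) :
    |expMixture c η t| ≤ |c| + ∫ s in Ioo (0 : ℝ) 1, ‖η s‖ := by
  refine (abs_add_le _ _).trans (add_le_add ?_ ?_)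
  · rw [abs_mul, Real.abs_exp]
    exact mul_le_of_le_one_right (abs_nonneg _)
      (Real.exp_le_one_iff.2 (by have : (0 : ℝ) < t := ht
                                 linarith))
  · refine norm_integral_le_of_norm_le (f := fun s => Real.exp (-(t * (1 - s))) * η s)
      hη.norm ?_
    filter_upwards [ae_restrict_mem measurableSet_Ioo] with s hs using norm_exp_mul_le ht hs

lemma integral_exp_neg_mul {r : ℝ} (hr : 0 < r) :
    ∫ t in Ioi (0 : ℝ), Real.exp (-(r * t)) = 1 / r := by
  have := integral_exp_mul_Ioi (a := -r) (by linarith) 0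
  simp only [neg_mul] at this
  rw [this]; simp

lemma integrableOn_exp_neg_mul {r : ℝ} (hr : 0 < r) :
    IntegrableOn (fun t => Real.exp (-(r * t))) (Ioi 0) := by
  simpa using integrableOn_pow_mul_exp_neg 0 hr

lemma laplaceMoment_expMixture (hη : IntegrableOn η (Ioo 0 1)) {x : ℝ} (hx : 0 < x) :
    laplaceMoment (expMixture c η) 0 x =
      c / (x + 1) + ∫ s in Ioo (0 : ℝ) 1, η s * (1 / (x + 1 - s)) := by
  have hprod : Integrable (Function.uncurry fun (t s : ℝ) =>
      Real.exp (-(x * t)) * (Real.exp (-(t * (1 - s))) * η s))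
      ((volume.restrict (Ioi (0 : ℝ))).prod (volume.restrict (Ioo (0 : ℝ) 1))) := by
    have h1 := (integrableOn_exp_neg_mul hx).integrable.mul_prod hη.integrable
    have h2 := h1.bdd_mul (c := 1) (f := fun p : ℝ × ℝ => Real.exp (-(p.1 * (1 - p.2))))
      (Continuous.aestronglyMeasurable (by fun_prop)) (by
        rw [Measure.prod_restrict]
        filter_upwards [ae_restrict_mem (measurableSet_Ioi.prod measurableSet_Ioo)] with p hp
        rw [Real.norm_of_nonneg (Real.exp_pos _).le]
        refine Real.exp_le_one_iff.2 ?_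
        have h3 : 0 < p.1 := hp.1
        have h4 : 0 < 1 - p.2 := by linarith [hp.2.2]
        have := mul_pos h3 h4
        linarith)
    refine h2.congr (ae_of_all _ fun p => ?_)
    simp only [Function.uncurry]
    ring
  have hswap := integral_integral_swap hprod
  have hleft : ∀ t : ℝ, t ^ 0 * Real.exp (-(x * t)) * expMixture c η t =
      c * Real.exp (-((x + 1) * t)) +
        ∫ s in Ioo (0 : ℝ) 1, Real.exp (-(x * t)) * (Real.exp (-(t * (1 - s))) * η s) := by
    intro t
    rw [integral_const_mul, expMixture, mul_add, pow_zero, one_mul]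
    congr 1
    rw [mul_left_comm, ← Real.exp_add]
    congr 2; ring
  simp only [laplaceMoment, hleft]
  have hinner : IntegrableOn (fun t => ∫ s in Ioo (0 : ℝ) 1,
      Real.exp (-(x * t)) * (Real.exp (-(t * (1 - s))) * η s)) (Ioi 0) := hprod.integral_prod_left
  rw [integral_add ((integrableOn_exp_neg_mul (by linarith)).const_mul c) hinner, hswap,
    integral_const_mul, integral_exp_neg_mul (by linarith), mul_one_div]
  congr 1
  refine setIntegral_congr_fun measurableSet_Ioo fun s hs => ?_
  have hs' : 0 < x + 1 - s := by linarith [hs.2]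
  rw [← integral_exp_neg_mul hs', ← integral_const_mul]
  refine integral_congr_ae (ae_of_all _ fun t => ?_)
  simp only
  rw [← mul_assoc, ← Real.exp_add, mul_comm]
  congr 2; ring

lemma exp_mul_expMixture (c : ℝ) (η : ℝ → ℝ) (t : ℝ) :
    Real.exp t * expMixture c η t = c + ∫ s in Ioo (0 : ℝ) 1, Real.exp (t * s) * η s := by
  rw [expMixture, mul_add, mul_left_comm, ← Real.exp_add, ← integral_const_mul]
  congr 1
  · simp
  · refine integral_congr_ae (ae_of_all _ fun s => ?_)
    simp only
    rw [← mul_assoc, ← Real.exp_add]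
    congr 2; ring

lemma hasSum_moments (hη : IntegrableOn η (Ioo 0 1)) (t : ℝ) :
    HasSum (fun n : ℕ => t ^ n / (Nat.factorial n : ℝ) * ∫ s in Ioo (0 : ℝ) 1, s ^ n * η s)
      (∫ s in Ioo (0 : ℝ) 1, Real.exp (t * s) * η s) := by
  have h := hasSum_integral_of_dominated_convergence
    (μ := volume.restrict (Ioo (0 : ℝ) 1))
    (F := fun (n : ℕ) s => t ^ n / (Nat.factorial n : ℝ) * (s ^ n * η s))
    (f := fun s => Real.exp (t * s) * η s)
    (bound := fun n s => |t| ^ n / (Nat.factorial n : ℝ) * ‖η s‖)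
    (fun n => ((Continuous.aestronglyMeasurable (by fun_prop)).mul hη.1).const_mul _)
    (fun n => by
      filter_upwards [ae_restrict_mem measurableSet_Ioo] with s hs
      rw [norm_mul, norm_mul, norm_div, norm_pow, norm_pow, Real.norm_eq_abs, RCLike.norm_natCast]
      gcongr
      refine mul_le_of_le_one_left (norm_nonneg _) (pow_le_one₀ (norm_nonneg _) ?_)
      rw [Real.norm_of_nonneg hs.1.le]
      exact hs.2.le)
    (ae_of_all _ fun s => (Real.summable_pow_div_factorial |t|).mul_right _)
    (by
      simp only [tsum_mul_right]
      exact hη.norm.const_mul _)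
    (ae_of_all _ fun s => by
      have h1 := (NormedSpace.expSeries_div_hasSum_exp (t * s)).mul_right (η s)
      rw [← Real.exp_eq_exp_ℝ] at h1
      have h2 : ∀ n : ℕ, (t * s) ^ n / (Nat.factorial n : ℝ) * η s =
          t ^ n / (Nat.factorial n : ℝ) * (s ^ n * η s) := fun n => by rw [mul_pow]; ring
      simpa only [h2] using h1)
  simpa only [integral_const_mul] using h

end Mixture

section Main

lemma hasDerivAt_mul_log {x : ℝ} (hx : 0 < x) :
    HasDerivAt (fun x : ℝ => x * Real.log (1 + 1 / x)) (Real.log (1 + 1 / x) - 1 / (x + 1)) x := by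
  have h1 : HasDerivAt (fun x : ℝ => 1 + 1 / x) (-(1 / x ^ 2)) x := by
    have := (hasDerivAt_inv hx.ne').const_add 1
    simpa using this
  have hpos : 0 < 1 + 1 / x := by positivity
  have h2 := (hasDerivAt_id x).mul (h1.log hpos.ne')
  refine h2.congr_deriv ?_
  simp only [id]
  field_simp
  ring

lemma hasDerivAt_log_sub {x : ℝ} (hx : 0 < x) :
    HasDerivAt (fun x : ℝ => Real.log (1 + 1 / x) - 1 / (x + 1)) (-(1 / (x * (x + 1) ^ 2))) x := by
  have h1 : HasDerivAt (fun x : ℝ => 1 + 1 / x) (-(1 / x ^ 2)) x := by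
    have := (hasDerivAt_inv hx.ne').const_add 1
    simpa using this
  have hpos : 0 < 1 + 1 / x := by positivity
  have hx1 : x + 1 ≠ 0 := by linarith
  have h3 : HasDerivAt (fun x : ℝ => 1 / (x + 1)) (-(1 / (x + 1) ^ 2)) x := by
    simpa only [one_div, id, neg_div] using ((hasDerivAt_id x).add_const 1).fun_inv hx1
  refine ((h1.log hpos.ne').sub h3).congr_deriv ?_
  field_simp
  ring

lemma log_sub_pos {x : ℝ} (hx : 0 < x) : 0 < Real.log (1 + 1 / x) - 1 / (x + 1) := by
  have hpos : 0 < 1 + 1 / x := by positivity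
  have hne : (1 + 1 / x)⁻¹ ≠ 1 := by
    have : 0 < 1 / x := by positivity
    exact inv_ne_one.2 (by linarith)
  have h := Real.log_lt_sub_one_of_pos (inv_pos.2 hpos) hne
  rw [Real.log_inv] at h
  have h2 : (1 + 1 / x)⁻¹ - 1 = -(1 / (x + 1)) := by field_simp; ring
  linarith

lemma neg_deriv_deriv_div_deriv_hfun {α x : ℝ} (hα : 0 < α) (hx : 0 < x) :
    -deriv (deriv (hfun α)) x / deriv (hfun α) x =
      1 / (x * (x + 1) * ((x + 1) * Real.log (1 + 1 / x) - 1)) -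
        α * (Real.log (1 + 1 / x) - 1 / (x + 1)) := by
  have hd : ∀ y : ℝ, 0 < y → HasDerivAt (hfun α)
      (hfun α y * (α * (Real.log (1 + 1 / y) - 1 / (y + 1)))) y := by
    intro y hy
    have h := ((hasDerivAt_mul_log hy).const_mul α).exp
    simp only [← mul_assoc α y] at h
    refine h.congr_of_eventuallyEq (Eventually.of_forall fun z => ?_)
    rw [hfun, mul_assoc]
  have hev : deriv (hfun α) =ᶠ[𝓝 x]
      fun y => hfun α y * (α * (Real.log (1 + 1 / y) - 1 / (y + 1))) :=
    (lt_mem_nhds hx).mono fun y hy => (hd y hy).deriv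
  have hd2 := (hd x hx).fun_mul ((hasDerivAt_log_sub hx).const_mul α)
  rw [hev.deriv_eq, hev.eq_of_nhds, hd2.deriv]
  have hpos := log_sub_pos hx
  have hh : hfun α x ≠ 0 := (Real.exp_pos _).ne'
  have h4 : (x + 1) * Real.log (1 + 1 / x) - 1 =
      (x + 1) * (Real.log (1 + 1 / x) - 1 / (x + 1)) := by field_simp
  rw [h4]
  generalize Real.log (1 + 1 / x) - 1 / (x + 1) = L at hpos ⊢
  field_simp
  ring

lemma integral_one_div_sub {x : ℝ} (hx : 0 < x) :
    ∫ s in Ioo (0 : ℝ) 1, 1 / (x + 1 - s) = Real.log (1 + 1 / x) := by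
  rw [← integral_Ioc_eq_integral_Ioo, ← intervalIntegral.integral_of_le zero_le_one,
    intervalIntegral.integral_comp_sub_left (fun y => 1 / y) (x + 1),
    integral_one_div_of_pos (by linarith) (by linarith)]
  congr 1
  rw [sub_zero, add_sub_cancel_right, add_div, div_self hx.ne']

lemma integrableOn_tau0_sub (α : ℝ) : IntegrableOn (fun s => tau0 (1 - s) - α) (Ioo 0 1) :=
  integrableOn_tau0.sub (integrableOn_const (by simp))

lemma integral_pow_mul_tau0_sub (α : ℝ) (n : ℕ) :
    ∫ s in Ioo (0 : ℝ) 1, s ^ n * (tau0 (1 - s) - α) = tmom n - α / ((n : ℝ) + 1) := by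
  have hint : IntegrableOn (fun s => s ^ n * tau0 (1 - s)) (Ioo 0 1) := by
    refine integrableOn_tau0.bdd_mul (c := 1) (Continuous.aestronglyMeasurable (by fun_prop)) ?_
    filter_upwards [ae_restrict_mem measurableSet_Ioo] with s hs
    rw [norm_pow, Real.norm_of_nonneg hs.1.le]
    exact pow_le_one₀ hs.1.le hs.2.le
  have hpow : IntegrableOn (fun s : ℝ => s ^ n * α) (Ioo 0 1) :=
    ((by fun_prop : Continuous fun s : ℝ => s ^ n * α).integrableOn_Icc (a := 0) (b := 1)).mono_set
      Ioo_subset_Icc_self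
  simp only [mul_sub]
  rw [integral_sub hint hpow, tmom, intervalIntegral.integral_of_le zero_le_one,
    integral_Ioc_eq_integral_Ioo]
  congr 1
  rw [← integral_Ioc_eq_integral_Ioo, ← intervalIntegral.integral_of_le zero_le_one,
    intervalIntegral.integral_mul_const, integral_pow]
  simp
  ring

lemma Gfun_eq_exp_mul_expMixture (α t : ℝ) :
    Gfun α t = Real.exp t * expMixture (1 + α) (fun s => tau0 (1 - s) - α) t := by
  have h := hasSum_moments (integrableOn_tau0_sub α) t
  simp only [integral_pow_mul_tau0_sub] at h
  have h' := ((hasSum_nat_add_iff' 1).2 h).tsum_eq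
  have h0 : tmom 0 = 1 := by
    rw [tmom, intervalIntegral.integral_of_le zero_le_one, integral_Ioc_eq_integral_Ioo]
    simpa using integral_tau0
  rw [exp_mul_expMixture, Gfun]
  have hcast : ∀ n : ℕ, ((n + 1 : ℕ) : ℝ) + 1 = n + 2 := fun n => by push_cast; ring
  simp only [hcast] at h'
  rw [h']
  simp [h0]
  ring

lemma laplaceMoment_eq {α x : ℝ} (hα : 0 < α) (hx : 0 < x) :
    laplaceMoment (expMixture (1 + α) fun s => tau0 (1 - s) - α) 0 x =
      -deriv (deriv (hfun α)) x / deriv (hfun α) x := by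
  have hbdd : ∀ᵐ s ∂(volume.restrict (Ioo (0 : ℝ) 1)), ‖1 / (x + 1 - s)‖ ≤ 1 / x := by
    filter_upwards [ae_restrict_mem measurableSet_Ioo] with s hs
    have : x ≤ x + 1 - s := by linarith [hs.2]
    rw [Real.norm_of_nonneg (by have := hx.trans_le this; positivity)]
    gcongr
  have hmeas : AEStronglyMeasurable (fun s : ℝ => 1 / (x + 1 - s))
      (volume.restrict (Ioo (0 : ℝ) 1)) :=
    Measurable.aestronglyMeasurable (by fun_prop)
  have hconst : IntegrableOn (fun _ : ℝ => α) (Ioo 0 1) := integrableOn_const (by simp)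
  rw [laplaceMoment_expMixture (integrableOn_tau0_sub α) hx, neg_deriv_deriv_div_deriv_hfun hα hx]
  simp only [sub_mul]
  rw [integral_sub (integrableOn_tau0.mul_bdd hmeas hbdd) (hconst.mul_bdd hmeas hbdd),
    integral_tau0_div hx, integral_const_mul, integral_one_div_sub hx]
  ring

lemma CompletelyMonotonicOn.congr {u v : ℝ → ℝ} (h : CompletelyMonotonicOn u)
    (huv : EqOn v u (Ioi 0)) : CompletelyMonotonicOn v := by
  refine ⟨h.1.congr huv, fun n x hx => ?_⟩
  rw [iteratedDerivWithin_congr huv hx]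
  exact h.2 n x hx

end Main

/-- For every `α > 0`: `−h_α″/h_α′` is completely monotonic on `(0,∞)` if and only if
`G_α(x) ≥ 0` for all `x > 0`. -/
theorem hbf_iff_G_nonneg (α : ℝ) (hα : 0 < α) :
    CompletelyMonotonicOn (fun x => -deriv (deriv (hfun α)) x / deriv (hfun α) x) ↔
    ∀ x : ℝ, 0 < x → 0 ≤ Gfun α x := by
  have heq : EqOn (laplaceMoment (expMixture (1 + α) fun s => tau0 (1 - s) - α) 0)
      (fun x => -deriv (deriv (hfun α)) x / deriv (hfun α) x) (Ioi 0) :=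
    fun x hx => laplaceMoment_eq hα hx
  have hη := integrableOn_tau0_sub α
  have hiff := completelyMonotonicOn_laplaceMoment_iff (continuousOn_expMixture (c := 1 + α) hη)
    (fun t ht => abs_expMixture_le hη ht)
  have hG : (∀ x : ℝ, 0 < x → 0 ≤ Gfun α x) ↔
      ∀ x : ℝ, 0 < x → 0 ≤ expMixture (1 + α) (fun s => tau0 (1 - s) - α) x := by
    simp only [Gfun_eq_exp_mul_expMixture, mul_nonneg_iff_of_pos_left (Real.exp_pos _)]
  rw [hG, ← hiff]
  exact ⟨fun h => h.congr heq, fun h => h.congr heq.symm⟩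
end

section
/- The moments t_n = ∫₀¹ sⁿ τ₀(1−s) ds satisfy t₀ = 1, t₁ = 2/3, t₂ = 5/9, t₃ = 67/135, t₄ = 371/810, and t₅ = 1465/3402, where τ₀(t) = ( t[(1−t)log((1−t)/t) − 1]² + π² t (1−t)² )^{−1}. -/
section StripIntegrals

open Complex MeasureTheory Filter Topology Set

/-- The closed strip `|Im z| ≤ π`. -/
def closedStrip : Set ℂ := {z | |z.im| ≤ Real.pi}

/-- The difference of the values of `G` on the lower and the upper edge of `closedStrip`. -/
noncomputable def stripJump (G : ℂ → ℂ) (x : ℝ) : ℂ :=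
  G (x - Real.pi * I) - G (x + Real.pi * I)

theorem sub_pi_mul_I_mem_closedStrip (x : ℝ) : (x : ℂ) - Real.pi * I ∈ closedStrip := by
  simp [closedStrip, abs_of_pos Real.pi_pos]

theorem add_pi_mul_I_mem_closedStrip (x : ℝ) : (x : ℂ) + Real.pi * I ∈ closedStrip := by
  simp [closedStrip, abs_of_pos Real.pi_pos]

theorem norm_le_of_mem_closedStrip {z : ℂ} (hz : z ∈ closedStrip) : ‖z‖ ≤ |z.re| + Real.pi :=
  (norm_le_abs_re_add_abs_im z).trans (add_le_add_right hz _)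

theorem ContinuousOn.continuous_lower_edge {G : ℂ → ℂ} (hG : ContinuousOn G (closedStrip \ {0})) :
    Continuous fun x : ℝ ↦ G (x - Real.pi * I) := by
  refine hG.comp_continuous (by fun_prop) fun x ↦ ⟨sub_pi_mul_I_mem_closedStrip x, fun h ↦ ?_⟩
  simpa [Real.pi_ne_zero] using congrArg im h

theorem ContinuousOn.continuous_upper_edge {G : ℂ → ℂ} (hG : ContinuousOn G (closedStrip \ {0})) :
    Continuous fun x : ℝ ↦ G (x + Real.pi * I) := by
  refine hG.comp_continuous (by fun_prop) fun x ↦ ⟨add_pi_mul_I_mem_closedStrip x, fun h ↦ ?_⟩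
  simpa [Real.pi_ne_zero] using congrArg im h

theorem ContinuousOn.continuous_stripJump {G : ℂ → ℂ} (hG : ContinuousOn G (closedStrip \ {0})) :
    Continuous (stripJump G) :=
  hG.continuous_lower_edge.sub hG.continuous_upper_edge

theorem tendsto_integral_vertical {G : ℂ → ℂ} (hG : ContinuousOn G closedStrip) {l : Filter ℝ}
    [l.IsCountablyGenerated] {c : ℂ} (h : Tendsto G (comap re l ⊓ 𝓟 closedStrip) (𝓝 c)) :
    Tendsto (fun T : ℝ ↦ ∫ y in (-Real.pi)..Real.pi, G (T + y * I)) l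
      (𝓝 (2 * Real.pi * c)) := by
  have hmem : ∀ T y : ℝ, y ∈ uIoc (-Real.pi) Real.pi → (T : ℂ) + y * I ∈ closedStrip := by
    intro T y hy
    rw [uIoc_of_le (by linarith [Real.pi_pos])] at hy
    simpa [closedStrip, abs_le] using ⟨hy.1.le, hy.2⟩
  have hc : 2 * (Real.pi : ℂ) * c = ∫ _ in (-Real.pi)..Real.pi, c := by
    rw [intervalIntegral.integral_const, real_smul]; push_cast; ring
  rw [hc]
  have hev : ∀ᶠ T in l, ∀ z ∈ closedStrip, z.re = T → ‖G z‖ ≤ ‖c‖ + 1 := by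
    have h1 := h.norm.eventually (ge_mem_nhds (lt_add_one ‖c‖))
    rw [eventually_inf_principal, eventually_comap] at h1
    filter_upwards [h1] with T hT z hz hzT using hT z hzT hz
  refine intervalIntegral.tendsto_integral_filter_of_dominated_convergence
    (fun _ ↦ ‖c‖ + 1) (.of_forall fun T ↦ ?_) ?_ (by simp) (.of_forall fun y hy ↦ ?_)
  · refine ContinuousOn.aestronglyMeasurable ?_ measurableSet_uIoc
    exact hG.comp (by fun_prop) (hmem T)
  · filter_upwards [hev] with T hT
    exact .of_forall fun y hy ↦ hT _ (hmem T y hy) (by simp)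
  · refine h.comp (tendsto_inf.2 ⟨tendsto_comap_iff.2 ?_, tendsto_principal.2 ?_⟩)
    · have : Tendsto (fun T : ℝ ↦ T) l l := tendsto_id
      simpa [Function.comp_def] using this
    · exact .of_forall fun T ↦ hmem T y hy

theorem tendsto_integral_stripJump_of_differentiableOn {G : ℂ → ℂ}
    (hG : DifferentiableOn ℂ G closedStrip) {c : ℂ}
    (hp : Tendsto G (comap re atTop ⊓ 𝓟 closedStrip) (𝓝 c))
    (hm : Tendsto G (comap re atBot ⊓ 𝓟 closedStrip) (𝓝 0)) :
    Tendsto (fun T : ℝ ↦ ∫ x in (-T)..T, stripJump G x) atTop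
      (𝓝 (-(2 * Real.pi * I * c))) := by
  have hG' : ContinuousOn G (closedStrip \ {0}) := hG.continuousOn.mono sdiff_subset
  have h1 := tendsto_integral_vertical hG.continuousOn hp
  have h2 := (tendsto_integral_vertical hG.continuousOn hm).comp tendsto_neg_atTop_atBot
  have h3 := (h2.sub h1).const_mul I
  have e : I * (2 * Real.pi * 0 - 2 * Real.pi * c) = -(2 * Real.pi * I * c) := by ring
  rw [e] at h3
  refine h3.congr fun T ↦ ?_
  have hr := integral_boundary_rect_eq_zero_of_differentiableOn G
    ((-T : ℝ) + (-Real.pi : ℝ) * I) ((T : ℝ) + (Real.pi : ℝ) * I) (hG.mono ?_)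
  · have hs : ∫ x in (-T)..T, stripJump G x
        = (∫ x in (-T)..T, G (x - Real.pi * I)) - ∫ x in (-T)..T, G (x + Real.pi * I) :=
      intervalIntegral.integral_sub (hG'.continuous_lower_edge.intervalIntegrable _ _)
        (hG'.continuous_upper_edge.intervalIntegrable _ _)
    simp only [add_re, ofReal_re, mul_re, I_re, mul_zero, ofReal_im, I_im, mul_one, sub_self,
      add_zero, add_im, mul_im, zero_add, smul_eq_mul] at hr
    simp only [ofReal_neg, neg_mul, ← sub_eq_add_neg] at hr
    rw [hs]
    simp only [Function.comp, ofReal_neg]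
    linear_combination -hr
  · intro z hz
    have := hz.2
    simp only [mem_preimage, add_im, ofReal_im, mul_im, ofReal_re, I_im, I_re, mul_one, mul_zero,
      add_zero, zero_add] at this
    rw [uIcc_of_le (by linarith [Real.pi_pos])] at this
    exact abs_le.2 this

theorem tendsto_integral_stripJump_inv :
    Tendsto (fun T : ℝ ↦ ∫ x in (-T)..T, stripJump (fun z ↦ z⁻¹) x) atTop
      (𝓝 (2 * Real.pi * I)) := by
  have hj : ∀ x : ℝ, stripJump (fun z ↦ z⁻¹) x
      = 2 * Real.pi * I * ((Real.pi ^ 2 + x ^ 2)⁻¹ : ℝ) := by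
    intro x
    have h1 : (x : ℂ) - Real.pi * I ≠ 0 := fun h ↦ by
      simpa [Real.pi_ne_zero] using congrArg im h
    have h2 : (x : ℂ) + Real.pi * I ≠ 0 := fun h ↦ by
      simpa [Real.pi_ne_zero] using congrArg im h
    have h3 : ((Real.pi : ℂ) ^ 2 + x ^ 2) = (x - Real.pi * I) * (x + Real.pi * I) := by
      linear_combination ((Real.pi : ℂ) ^ 2) * I_sq
    simp only [stripJump]
    push_cast
    rw [h3]
    field_simp
    ring
  have hi : ∀ T : ℝ, ∫ x in (-T)..T, stripJump (fun z ↦ z⁻¹) x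
      = 2 * Real.pi * I * ((Real.pi⁻¹ * (2 * Real.arctan (T / Real.pi)) : ℝ)) := by
    intro T
    simp only [hj]
    rw [intervalIntegral.integral_const_mul, intervalIntegral.integral_ofReal,
      integral_inv_sq_add_sq Real.pi_ne_zero, neg_div, Real.arctan_neg]
    ring_nf
  simp only [hi]
  have hl : Tendsto (fun T : ℝ ↦ Real.pi⁻¹ * (2 * Real.arctan (T / Real.pi))) atTop (𝓝 1) := by
    have : Real.pi⁻¹ * (2 * (Real.pi / 2)) = 1 := by field_simp
    rw [← this]
    exact ((((tendsto_nhds_of_tendsto_nhdsWithin Real.tendsto_arctan_atTop).comp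
      (tendsto_id.atTop_div_const Real.pi_pos)).const_mul 2).const_mul _)
  simpa using ((continuous_ofReal.tendsto 1).comp hl).const_mul (2 * Real.pi * I : ℂ)

theorem tendsto_integral_stripJump_inv_pow (k : ℕ) :
    Tendsto (fun T : ℝ ↦ ∫ x in (-T)..T, stripJump (fun z ↦ (z ^ (k + 2))⁻¹) x) atTop
      (𝓝 0) := by
  have hne : ∀ (x a : ℝ), a ≠ 0 → (x : ℂ) + a * I ≠ 0 := fun x a ha h ↦
    ha (by simpa using congrArg im h)
  have hcont : ∀ a : ℝ, a ≠ 0 → Continuous fun x : ℝ ↦ (((x : ℂ) + a * I) ^ (k + 2))⁻¹ :=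
    fun a ha ↦ Continuous.inv₀ (by fun_prop) fun x ↦ pow_ne_zero _ (hne x a ha)
  have hprim : ∀ a : ℝ, a ≠ 0 → ∀ T : ℝ, ∫ x in (-T)..T, (((x : ℂ) + a * I) ^ (k + 2))⁻¹
      = -((k : ℂ) + 1)⁻¹ * ((T + a * I) ^ (k + 1))⁻¹
        - -((k : ℂ) + 1)⁻¹ * (((-T : ℝ) + a * I) ^ (k + 1))⁻¹ := by
    intro a ha T
    refine intervalIntegral.integral_eq_sub_of_hasDerivAt (f := fun x : ℝ ↦
      -((k : ℂ) + 1)⁻¹ * (((x : ℂ) + a * I) ^ (k + 1))⁻¹) (fun x _ ↦ ?_)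
      ((hcont a ha).intervalIntegrable _ _)
    have hk : (k : ℂ) + 1 ≠ 0 := by exact_mod_cast k.succ_ne_zero
    have h0 := hne x a ha
    have h1 := (((hasDerivAt_id (x : ℂ)).add_const ((a : ℂ) * I)).pow (k + 1)).inv
      (pow_ne_zero _ h0)
    refine ((h1.const_mul (-((k : ℂ) + 1)⁻¹)).comp_ofReal).congr_deriv ?_
    simp only [id, Pi.pow_apply]
    push_cast
    field_simp
    ring
  have hzero : ∀ a : ℝ, Tendsto (fun T : ℝ ↦ (((T : ℂ) + a * I) ^ (k + 1))⁻¹) (cocompact ℝ)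
      (𝓝 0) := by
    intro a
    have h1 : Tendsto (fun T : ℝ ↦ (T : ℂ) + a * I) (cocompact ℝ) (cocompact ℂ) := by
      refine tendsto_cocompact_of_tendsto_dist_comp_atTop 0 ?_
      simp only [dist_zero_right]
      refine tendsto_atTop_mono (fun T ↦ ?_) (tendsto_norm_cocompact_atTop (E := ℝ))
      simpa using abs_re_le_norm ((T : ℂ) + a * I)
    have h2 := ((tendsto_inv₀_cobounded (α := ℂ)).comp
      (Metric.cobounded_eq_cocompact (α := ℂ) ▸ h1)).pow (k + 1)
    simpa [Function.comp_def] using h2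
  have hedge : ∀ a : ℝ, a ≠ 0 → Tendsto (fun T : ℝ ↦
      ∫ x in (-T)..T, (((x : ℂ) + a * I) ^ (k + 2))⁻¹) atTop (𝓝 0) := by
    intro a ha
    simp only [hprim a ha]
    simpa using (((hzero a).mono_left atTop_le_cocompact).const_mul (-((k : ℂ) + 1)⁻¹)).sub
      ((((hzero a).mono_left atBot_le_cocompact).comp tendsto_neg_atTop_atBot).const_mul
        (-((k : ℂ) + 1)⁻¹))
  have hd := (hedge (-Real.pi) (by simp [Real.pi_ne_zero])).sub (hedge Real.pi Real.pi_ne_zero)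
  rw [sub_zero] at hd
  refine hd.congr fun T ↦ ?_
  rw [← intervalIntegral.integral_sub ((hcont _ (by simp [Real.pi_ne_zero])).intervalIntegrable _ _)
    ((hcont _ Real.pi_ne_zero).intervalIntegrable _ _)]
  simp [stripJump, sub_eq_add_neg]

end StripIntegrals

section ExpStrip

open Complex Filter Topology Set

theorem eq_zero_of_exp_eq_one_of_mem_closedStrip {z : ℂ} (hz : z ∈ closedStrip)
    (h : exp z = 1) : z = 0 := by
  obtain ⟨n, rfl⟩ := exp_eq_one_iff.1 h
  have h1 : |(n : ℝ) * (2 * Real.pi)| ≤ Real.pi := by simpa [closedStrip] using hz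
  rw [abs_mul, abs_of_pos Real.two_pi_pos] at h1
  have h2 : |(n : ℝ)| < 1 := by nlinarith [Real.pi_pos]
  have h3 : n = 0 := Int.abs_lt_one_iff.1 (by exact_mod_cast h2)
  simp [h3]

theorem Real.exp_mul_sin_ne_of_exp_mul_cos {x y : ℝ} (hy : 0 < y) (hy' : y ≤ Real.pi)
    (hc : Real.exp x * Real.cos y = 1 + x) : Real.exp x * Real.sin y ≠ y := by
  intro hs
  have hsin : 0 < Real.sin y := by
    by_contra! h
    nlinarith [Real.exp_pos x]
  have hx : 0 < x := by
    by_contra! h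
    nlinarith [Real.exp_le_one_iff.2 h, Real.sin_lt hy]
  have hcos : 0 < Real.cos y := by
    by_contra! h
    nlinarith [Real.exp_pos x]
  have hy2 : y < Real.pi / 2 := by
    by_contra! h
    exact hcos.not_ge (Real.cos_nonpos_of_pi_div_two_le_of_le h (by linarith [Real.pi_pos]))
  have ht := Real.lt_tan hy hy2
  rw [Real.tan_eq_sin_div_cos, lt_div_iff₀ hcos] at ht
  have : y * Real.cos y = (1 + x) * Real.sin y := by
    linear_combination (-Real.cos y) * hs + Real.sin y * hc
  nlinarith [mul_pos hx hsin]

theorem eq_zero_of_exp_eq_one_add_of_mem_closedStrip {z : ℂ} (hz : z ∈ closedStrip)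
    (h : exp z = 1 + z) : z = 0 := by
  have hre : Real.exp z.re * Real.cos z.im = 1 + z.re := by
    simpa [exp_re] using congrArg re h
  have him : Real.exp z.re * Real.sin z.im = z.im := by
    simpa [exp_im] using congrArg im h
  obtain ⟨hl, hu⟩ := abs_le.1 (show |z.im| ≤ Real.pi from hz)
  rcases lt_trichotomy z.im 0 with hy | hy | hy
  · exact absurd (by rw [Real.sin_neg]; linarith) (Real.exp_mul_sin_ne_of_exp_mul_cos
      (x := z.re) (y := -z.im) (by linarith) (by linarith) (by rwa [Real.cos_neg]))
  · refine Complex.ext ?_ hy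
    by_contra hx
    rw [hy, Real.cos_zero, mul_one] at hre
    linarith [Real.add_one_lt_exp hx]
  · exact absurd him (Real.exp_mul_sin_ne_of_exp_mul_cos hy hu hre)

theorem exists_differentiable_exp_eq_sum_add (n : ℕ) :
    ∃ E : ℂ → ℂ, Differentiable ℂ E ∧
      ∀ z, exp z = ∑ k ∈ Finset.range (n + 1), z ^ k / k.factorial + z ^ (n + 1) * E z := by
  set f : ℂ → ℂ := fun z ↦
    (exp z - ∑ k ∈ Finset.range (n + 1), z ^ k / k.factorial) / z ^ (n + 1) with hf
  have hdiff : DifferentiableOn ℂ f {0}ᶜ := by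
    refine DifferentiableOn.div (by fun_prop) (by fun_prop) fun z hz ↦ pow_ne_zero _ hz
  set E := Function.update f 0 (limUnder (𝓝[≠] 0) f) with hE
  have hball : DifferentiableOn ℂ E (Metric.ball 0 1) := by
    refine differentiableOn_update_limUnder_of_bddAbove (Metric.ball_mem_nhds _ one_pos)
      (hdiff.mono fun z hz ↦ hz.2)
      ⟨((n + 1).succ : ℝ) * ((n + 1).factorial * (n + 1 : ℕ) : ℝ)⁻¹, ?_⟩
    rintro _ ⟨z, hz, rfl⟩
    have hz1 : ‖z‖ ≤ 1 := by simpa using (mem_ball_zero_iff.1 hz.1).le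
    have hz0 : 0 < ‖z‖ := norm_pos_iff.2 hz.2
    rw [Function.comp, hf, norm_div, norm_pow, div_le_iff₀ (by positivity), mul_comm]
    exact exp_bound hz1 n.succ_pos
  refine ⟨E, fun z ↦ ?_, fun z ↦ ?_⟩
  · by_cases hz : z = 0
    · exact hball.differentiableAt (hz ▸ Metric.ball_mem_nhds _ one_pos)
    · refine (hdiff.differentiableAt (isOpen_compl_singleton.mem_nhds hz)).congr_of_eventuallyEq ?_
      filter_upwards [isOpen_compl_singleton.mem_nhds hz] with w hw
      exact Function.update_of_ne hw _ _
  · by_cases hz : z = 0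
    · simp [hz, Finset.sum_range_succ']
    · rw [hE, Function.update_of_ne hz]
      simp only [hf]
      field_simp
      ring

/-- The meromorphic function whose jump across `closedStrip` gives the density of the moments. -/
noncomputable def momentKernel (n : ℕ) (z : ℂ) : ℂ :=
  ((1 - exp z) ^ n)⁻¹ * ((1 - exp z) / (z + 1 - exp z))

theorem tendsto_inv_closedStrip {l : Filter ℝ} (hl : Tendsto (fun x : ℝ ↦ |x|) l atTop) :
    Tendsto (fun z : ℂ ↦ z⁻¹) (comap re l ⊓ 𝓟 closedStrip) (𝓝 0) := by
  refine tendsto_inv₀_cobounded.comp (tendsto_norm_atTop_iff_cobounded.1 ?_)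
  exact tendsto_atTop_mono abs_re_le_norm ((hl.comp tendsto_comap).mono_left inf_le_left)

theorem tendsto_momentKernel_atBot (n : ℕ) :
    Tendsto (momentKernel n) (comap re atBot ⊓ 𝓟 closedStrip) (𝓝 0) := by
  set l := comap re atBot ⊓ 𝓟 closedStrip
  have hinv : Tendsto (fun z : ℂ ↦ z⁻¹) l (𝓝 0) := tendsto_inv_closedStrip tendsto_abs_atBot_atTop
  have hexp : Tendsto exp l (𝓝 0) := tendsto_exp_comap_re_atBot.mono_left inf_le_left
  have h1 : Tendsto (fun z ↦ 1 - exp z) l (𝓝 1) := by simpa using hexp.const_sub 1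
  have h2 : Tendsto (fun z ↦ ((1 - exp z) ^ n)⁻¹ * (z⁻¹ * (1 - exp z) /
      (1 + z⁻¹ * (1 - exp z)))) l (𝓝 (((1 : ℂ) ^ n)⁻¹ * (0 * 1 / (1 + 0 * 1)))) :=
    ((h1.pow n).inv₀ (by simp)).mul
      ((hinv.mul h1).div ((hinv.mul h1).const_add 1) (by simp))
  simp only [zero_mul, zero_div, mul_zero] at h2
  refine h2.congr' ?_
  have hne : ∀ᶠ z in l, z ≠ 0 := by
    have : ∀ᶠ z in l, z.re < 0 :=
      (tendsto_comap.mono_left inf_le_left).eventually (eventually_lt_atBot 0)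
    filter_upwards [this] with z hz h
    simp [h] at hz
  filter_upwards [hne] with z hz
  have : z + 1 - exp z = z * (1 + z⁻¹ * (1 - exp z)) := by field_simp; ring
  rw [momentKernel, this, ← div_div]
  congr 2
  field_simp

theorem tendsto_momentKernel_atTop (n : ℕ) :
    Tendsto (momentKernel n) (comap re atTop ⊓ 𝓟 closedStrip) (𝓝 (0 ^ n)) := by
  set l := comap re atTop ⊓ 𝓟 closedStrip
  have hre : Tendsto re l atTop := tendsto_comap.mono_left inf_le_left
  have hexp : Tendsto (fun z ↦ exp (-z)) l (𝓝 0) := by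
    refine tendsto_exp_nhds_zero_iff.2 ?_
    simpa using hre
  have hz : Tendsto (fun z ↦ z * exp (-z)) l (𝓝 0) := by
    have hb : Tendsto (fun x : ℝ ↦ (|x| + Real.pi) * Real.exp (-x)) atTop (𝓝 0) := by
      have h1 : Tendsto (fun x : ℝ ↦ x * Real.exp (-x)) atTop (𝓝 0) := by
        simpa using Real.tendsto_pow_mul_exp_neg_atTop_nhds_zero 1
      have h2 := h1.add (Real.tendsto_exp_neg_atTop_nhds_zero.const_mul Real.pi)
      simp only [mul_zero, add_zero] at h2
      refine h2.congr' ?_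
      filter_upwards [eventually_ge_atTop 0] with x hx
      rw [abs_of_nonneg hx]; ring
    refine squeeze_zero_norm' ?_ (hb.comp hre)
    filter_upwards [mem_inf_of_right (mem_principal_self closedStrip)] with z hz
    rw [norm_mul, norm_exp, neg_re]
    exact mul_le_mul_of_nonneg_right (norm_le_of_mem_closedStrip hz) (Real.exp_pos _).le
  have hw : Tendsto (fun z ↦ exp (-z) - 1) l (𝓝 (-1)) := by simpa using hexp.sub_const 1
  have hq : Tendsto (fun z ↦ (exp (-z) / (exp (-z) - 1)) ^ n * ((exp (-z) - 1) /
      (z * exp (-z) + (exp (-z) - 1)))) l (𝓝 ((0 / (-1)) ^ n * (-1 / (0 + -1)))) :=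
    ((hexp.div hw (by simp)).pow n).mul (hw.div (hz.add hw) (by simp))
  have e : ((0 : ℂ) / (-1)) ^ n * (-1 / (0 + -1)) = 0 ^ n := by simp
  rw [e] at hq
  refine hq.congr fun z ↦ ?_
  have h0 : exp z ≠ 0 := exp_ne_zero z
  have h1 : exp (-z) - 1 = (1 - exp z) / exp z := by rw [exp_neg]; field_simp
  have h2 : z * exp (-z) + (exp (-z) - 1) = (z + 1 - exp z) / exp z := by
    rw [exp_neg]; field_simp; ring
  rw [h2, h1, div_div_div_cancel_right₀ h0, exp_neg, inv_eq_one_div,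
    div_div_div_cancel_right₀ h0, div_pow, one_pow, one_div, momentKernel]

theorem stripJump_momentKernel (n : ℕ) (x : ℝ) :
    stripJump (momentKernel n) x = 2 * Real.pi * I *
      ((((1 + Real.exp x) ^ n)⁻¹ * ((1 + Real.exp x) /
        ((x + 1 + Real.exp x) ^ 2 + Real.pi ^ 2)) : ℝ) : ℂ) := by
  have e1 : exp (x - Real.pi * I) = -Real.exp x := by
    rw [exp_sub, exp_pi_mul_I]; simp [div_neg]
  have e2 : exp (x + Real.pi * I) = -Real.exp x := by
    rw [exp_add, exp_pi_mul_I]; simp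
  simp only [stripJump, momentKernel, e1, e2, sub_neg_eq_add]
  push_cast
  have h1 : (x : ℂ) - Real.pi * I + 1 + exp x ≠ 0 := fun h ↦ by
    have := congrArg im h
    rw [← ofReal_exp] at this
    simp [Real.pi_ne_zero] at this
  have h2 : (x : ℂ) + Real.pi * I + 1 + exp x ≠ 0 := fun h ↦ by
    have := congrArg im h
    rw [← ofReal_exp] at this
    simp [Real.pi_ne_zero] at this
  have h3 : ((x : ℂ) + 1 + exp x) ^ 2 + Real.pi ^ 2
      = (x - Real.pi * I + 1 + exp x) * (x + Real.pi * I + 1 + exp x) := by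
    linear_combination ((Real.pi : ℂ) ^ 2) * I_sq
  rw [h3, ← mul_sub, div_sub_div _ _ h1 h2, mul_left_comm]
  congr 1
  ring

end ExpStrip

section Moments

open MeasureTheory Filter Topology Set

theorem tmom_eq_integral (n : ℕ) :
    tmom n = ∫ u : ℝ, ((1 + Real.exp u) ^ n)⁻¹ * ((1 + Real.exp u) /
      ((u + 1 + Real.exp u) ^ 2 + Real.pi ^ 2)) := by
  have hpos : ∀ u : ℝ, 0 < 1 + Real.exp u := fun u ↦ by positivity
  have himg : image (fun u : ℝ ↦ (1 + Real.exp u)⁻¹) univ = Ioo 0 1 := by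
    ext s
    simp only [image_univ, mem_range, mem_Ioo]
    constructor
    · rintro ⟨u, rfl⟩
      exact ⟨inv_pos.2 (hpos u), inv_lt_one_of_one_lt₀ (by linarith [Real.exp_pos u])⟩
    · rintro ⟨h0, h1⟩
      refine ⟨Real.log (s⁻¹ - 1), ?_⟩
      rw [Real.exp_log (by linarith [(one_lt_inv₀ h0).2 h1])]
      simp
  have hinj : InjOn (fun u : ℝ ↦ (1 + Real.exp u)⁻¹) univ := fun u _ v _ h ↦ by simpa using h
  have hderiv : ∀ u ∈ (univ : Set ℝ), HasDerivWithinAt (fun u : ℝ ↦ (1 + Real.exp u)⁻¹)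
      (-Real.exp u / (1 + Real.exp u) ^ 2) univ u := fun u _ ↦
    (((Real.hasDerivAt_exp u).const_add 1).inv (hpos u).ne').hasDerivWithinAt
  rw [tmom, intervalIntegral.integral_of_le zero_le_one, integral_Ioc_eq_integral_Ioo, ← himg,
    integral_image_eq_integral_abs_deriv_smul MeasurableSet.univ hderiv hinj, setIntegral_univ]
  refine integral_congr_ae (.of_forall fun u ↦ ?_)
  have h1 : 1 - (1 - (1 + Real.exp u)⁻¹) = (1 + Real.exp u)⁻¹ := by ring
  have h2 : 1 - (1 + Real.exp u)⁻¹ = Real.exp u / (1 + Real.exp u) := by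
    have := (hpos u).ne'
    field_simp
    ring
  have h3 : (1 + Real.exp u)⁻¹ / (Real.exp u / (1 + Real.exp u)) = Real.exp (-u) := by
    have := (hpos u).ne'
    rw [Real.exp_neg]
    field_simp
  have h4 : 0 < (u + 1 + Real.exp u) ^ 2 + Real.pi ^ 2 := by positivity
  have h5 : Real.exp u / (1 + Real.exp u) * ((1 + Real.exp u)⁻¹ * -u - 1) ^ 2
      + Real.pi ^ 2 * (Real.exp u / (1 + Real.exp u)) * (1 + Real.exp u)⁻¹ ^ 2
      = Real.exp u / (1 + Real.exp u) ^ 3 * ((u + 1 + Real.exp u) ^ 2 + Real.pi ^ 2) := by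
    have := (hpos u).ne'
    field_simp
    ring
  simp only [tau0, h1, smul_eq_mul]
  rw [h2, h3, Real.log_exp, h5, neg_div, abs_neg, abs_of_pos (by positivity), inv_pow]
  have := (hpos u).ne'
  field_simp

theorem tendsto_integral_stripJump_momentKernel {n : ℕ} {c : ℂ} {b : ℕ → ℂ} {R : ℂ → ℂ}
    (hR : DifferentiableOn ℂ R closedStrip)
    (h : ∀ z ∈ closedStrip \ {0}, momentKernel n z =
      c * z⁻¹ + ∑ k ∈ Finset.range n, b k * (z ^ (k + 2))⁻¹ + R z) :
    Tendsto (fun T : ℝ ↦ ∫ x in (-T)..T, stripJump (momentKernel n) x) atTop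
      (𝓝 (2 * Real.pi * Complex.I * (c - 0 ^ n))) := by
  have hRlim : ∀ {l : Filter ℝ} {d : ℂ}, Tendsto (fun x : ℝ ↦ |x|) l atTop →
      Tendsto (momentKernel n) (comap Complex.re l ⊓ 𝓟 closedStrip) (𝓝 d) →
      Tendsto R (comap Complex.re l ⊓ 𝓟 closedStrip) (𝓝 d) := by
    intro l d hl hd
    have hinv := tendsto_inv_closedStrip hl
    have h1 := (hd.sub (hinv.const_mul c)).sub (tendsto_finsetSum (Finset.range n) fun k _ ↦
      ((hinv.pow (k + 2)).const_mul (b k)))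
    simp only [mul_zero, sub_zero, ne_eq, Nat.add_eq_zero_iff, OfNat.ofNat_ne_zero, and_false,
      not_false_eq_true, zero_pow, Finset.sum_const_zero] at h1
    refine h1.congr' ?_
    have hre := (hl.comp tendsto_comap).mono_left
      (inf_le_left (a := comap Complex.re l) (b := 𝓟 closedStrip))
    filter_upwards [mem_inf_of_right (mem_principal_self closedStrip),
      hre.eventually (eventually_gt_atTop 0)] with z hz hz0
    have hz' : z ≠ 0 := by
      rintro rfl
      simp at hz0
    rw [h z ⟨hz, hz'⟩]
    simp only [inv_pow]
    ring
  have hRval := tendsto_integral_stripJump_of_differentiableOn hR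
    (hRlim tendsto_abs_atTop_atTop (tendsto_momentKernel_atTop n))
    (hRlim tendsto_abs_atBot_atTop (tendsto_momentKernel_atBot n))
  have hsum := ((tendsto_integral_stripJump_inv.const_mul c).add
    (tendsto_finsetSum (Finset.range n) fun k _ ↦
      (tendsto_integral_stripJump_inv_pow k).const_mul (b k))).add hRval
  have e : c * (2 * Real.pi * Complex.I) + ∑ k ∈ Finset.range n, b k * 0
      + -(2 * Real.pi * Complex.I * 0 ^ n) = 2 * Real.pi * Complex.I * (c - 0 ^ n) := by
    simp only [mul_zero, Finset.sum_const_zero]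
    ring
  rw [e] at hsum
  refine hsum.congr fun T ↦ ?_
  have hcinv : Continuous (stripJump fun z ↦ z⁻¹) :=
    ContinuousOn.continuous_stripJump (continuousOn_inv₀.mono fun z hz ↦ hz.2)
  have hcpow : ∀ k : ℕ, Continuous (stripJump fun z ↦ (z ^ (k + 2))⁻¹) := fun k ↦
    ContinuousOn.continuous_stripJump
      ((by fun_prop : ContinuousOn (fun z : ℂ ↦ z ^ (k + 2)) _).inv₀ fun z hz ↦ pow_ne_zero _ hz.2)
  have hcR : Continuous (stripJump R) :=
    ContinuousOn.continuous_stripJump (hR.continuousOn.mono sdiff_subset)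
  have hpt : ∀ x : ℝ, stripJump (momentKernel n) x = c * stripJump (fun z ↦ z⁻¹) x
      + ∑ k ∈ Finset.range n, b k * stripJump (fun z ↦ (z ^ (k + 2))⁻¹) x + stripJump R x := by
    intro x
    have hl : (x : ℂ) - Real.pi * Complex.I ∈ closedStrip \ {0} :=
      ⟨sub_pi_mul_I_mem_closedStrip x, fun h ↦ by
        simpa [Real.pi_ne_zero] using congrArg Complex.im h⟩
    have hu : (x : ℂ) + Real.pi * Complex.I ∈ closedStrip \ {0} :=
      ⟨add_pi_mul_I_mem_closedStrip x, fun h ↦ by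
        simpa [Real.pi_ne_zero] using congrArg Complex.im h⟩
    simp only [stripJump, h _ hl, h _ hu, mul_sub, Finset.sum_sub_distrib]
    ring
  have hi : ∀ {g : ℝ → ℂ}, Continuous g → IntervalIntegrable g volume (-T) T :=
    fun hg ↦ hg.intervalIntegrable _ _
  have hc1 : Continuous fun x ↦ c * stripJump (fun z ↦ z⁻¹) x := hcinv.const_mul c
  have hc2 : Continuous fun x ↦
      ∑ k ∈ Finset.range n, b k * stripJump (fun z ↦ (z ^ (k + 2))⁻¹) x :=
    continuous_finsetSum _ fun k _ ↦ (hcpow k).const_mul (b k)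
  have hc12 : Continuous fun x ↦ c * stripJump (fun z ↦ z⁻¹) x +
      ∑ k ∈ Finset.range n, b k * stripJump (fun z ↦ (z ^ (k + 2))⁻¹) x := hc1.add hc2
  simp only [hpt]
  rw [intervalIntegral.integral_add (hi hc12) (hi hcR),
    intervalIntegral.integral_add (hi hc1) (hi hc2),
    intervalIntegral.integral_finsetSum fun k _ ↦ hi ((hcpow k).const_mul (b k)),
    intervalIntegral.integral_const_mul]
  simp only [intervalIntegral.integral_const_mul]

theorem tmom_eq_of_momentKernel_eq {n : ℕ} {c : ℝ} {b : ℕ → ℂ} {R : ℂ → ℂ}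
    (hR : DifferentiableOn ℂ R closedStrip)
    (h : ∀ z ∈ closedStrip \ {0}, momentKernel n z =
      c * z⁻¹ + ∑ k ∈ Finset.range n, b k * (z ^ (k + 2))⁻¹ + R z) :
    tmom n = c - 0 ^ n := by
  set f : ℝ → ℝ := fun u ↦ ((1 + Real.exp u) ^ n)⁻¹ * ((1 + Real.exp u) /
    ((u + 1 + Real.exp u) ^ 2 + Real.pi ^ 2))
  have hf0 : ∀ u, 0 ≤ f u := fun u ↦ by positivity
  have hfc : Continuous f := by
    have h1 : ∀ u : ℝ, (1 + Real.exp u) ^ n ≠ 0 := fun u ↦ by positivity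
    have h2 : ∀ u : ℝ, (u + 1 + Real.exp u) ^ 2 + Real.pi ^ 2 ≠ 0 := fun u ↦ by positivity
    exact Continuous.mul (Continuous.inv₀ (by fun_prop) h1)
      (Continuous.div (by fun_prop) (by fun_prop) h2)
  have hpi : 2 * (Real.pi : ℂ) * Complex.I ≠ 0 := Complex.two_pi_I_ne_zero
  have hlim : Tendsto (fun T : ℝ ↦ ∫ u in (-T)..T, f u) atTop (𝓝 (c - 0 ^ n)) := by
    have h1 := (tendsto_integral_stripJump_momentKernel hR h).const_mul
      (2 * (Real.pi : ℂ) * Complex.I)⁻¹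
    rw [inv_mul_cancel_left₀ hpi] at h1
    have h2 := (Complex.continuous_re.tendsto _).comp h1
    have e : ((c : ℂ) - 0 ^ n).re = c - 0 ^ n := by
      rw [← Complex.ofReal_zero, ← Complex.ofReal_pow, ← Complex.ofReal_sub, Complex.ofReal_re]
    rw [e] at h2
    refine h2.congr fun T ↦ ?_
    simp only [Function.comp, stripJump_momentKernel]
    rw [intervalIntegral.integral_const_mul, inv_mul_cancel_left₀ hpi,
      intervalIntegral.integral_ofReal, Complex.ofReal_re]
  have hint : Integrable f := by
    refine integrable_of_intervalIntegral_norm_tendsto (c - 0 ^ n)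
      (fun T : ℝ ↦ (hfc.integrableOn_Ioc)) tendsto_neg_atTop_atBot tendsto_id ?_
    simpa only [Real.norm_of_nonneg (hf0 _), id] using hlim
  rw [tmom_eq_integral]
  exact tendsto_nhds_unique
    (intervalIntegral_tendsto_integral hint tendsto_neg_atTop_atBot tendsto_id) hlim

end Moments

section Expansions

open Complex Set

/-- `f` agrees on `closedStrip` with the polynomial `∑ k < 6, a k * z ^ k` up to `z ^ 6` times a
holomorphic function. -/
def HasSexticExpansion (f : ℂ → ℂ) (a : ℕ → ℚ) : Prop :=
  ∃ R : ℂ → ℂ, DifferentiableOn ℂ R closedStrip ∧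
    ∀ z ∈ closedStrip, f z = ∑ k ∈ Finset.range 6, (a k : ℂ) * z ^ k + z ^ 6 * R z

theorem HasSexticExpansion.div {f g : ℂ → ℂ} {a b q : ℕ → ℚ} (hf : HasSexticExpansion f a)
    (hg : HasSexticExpansion g b) (hg0 : ∀ z ∈ closedStrip, g z ≠ 0)
    (hq : ∀ k < 6, ∑ ij ∈ Finset.HasAntidiagonal.antidiagonal k, q ij.1 * b ij.2 = a k) :
    HasSexticExpansion (fun z ↦ f z / g z) q := by
  obtain ⟨R, hR, hfR⟩ := hf
  obtain ⟨S, hS, hgS⟩ := hg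
  have hgd : DifferentiableOn ℂ g closedStrip :=
    DifferentiableOn.congr (f := fun z ↦ ∑ k ∈ Finset.range 6, (b k : ℂ) * z ^ k + z ^ 6 * S z)
      (by fun_prop) hgS
  set Q : ℂ → ℂ := fun z ↦ ∑ k ∈ Finset.range 6, (q k : ℂ) * z ^ k with hQ
  set B : ℂ → ℂ := fun z ↦ ∑ k ∈ Finset.range 6, (b k : ℂ) * z ^ k with hB
  obtain ⟨O, hO, hQB⟩ : ∃ O : ℂ → ℂ, Differentiable ℂ O ∧ ∀ z,
      Q z * B z = ∑ k ∈ Finset.range 6, (a k : ℂ) * z ^ k + z ^ 6 * O z := by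
    refine ⟨fun z ↦ (q 1 * b 5 + q 2 * b 4 + q 3 * b 3 + q 4 * b 2 + q 5 * b 1)
      + (q 2 * b 5 + q 3 * b 4 + q 4 * b 3 + q 5 * b 2) * z
      + (q 3 * b 5 + q 4 * b 4 + q 5 * b 3) * z ^ 2
      + (q 4 * b 5 + q 5 * b 4) * z ^ 3 + q 5 * b 5 * z ^ 4, by fun_prop, fun z ↦ ?_⟩
    have ha : ∑ k ∈ Finset.range 6, (a k : ℂ) * z ^ k = ∑ k ∈ Finset.range 6,
        (∑ ij ∈ Finset.HasAntidiagonal.antidiagonal k, (q ij.1 : ℂ) * b ij.2) * z ^ k :=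
      Finset.sum_congr rfl fun k hk ↦ by rw [← hq k (Finset.mem_range.1 hk)]; push_cast; rfl
    rw [ha]
    simp only [hQ, hB, Finset.sum_range_succ, Finset.sum_range_zero,
      Finset.Nat.sum_antidiagonal_eq_sum_range_succ_mk]
    norm_num
    ring
  refine ⟨fun z ↦ (R z - O z - Q z * S z) / g z, ?_, fun z hz ↦ ?_⟩
  · exact DifferentiableOn.div (by fun_prop) hgd hg0
  · have h0 := hg0 z hz
    have h1 := hfR z hz
    have h2 := hgS z hz
    have h3 := hQB z
    change _ = Q z + _
    field_simp
    linear_combination h1 - Q z * h2 - h3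

theorem tmom_eq_of_hasSexticExpansion {f : ℂ → ℂ} {a : ℕ → ℚ} (hf : HasSexticExpansion f a)
    {n : ℕ} (hn : n < 6) (h : ∀ z ∈ closedStrip \ {0}, momentKernel n z = f z / z ^ (n + 1)) :
    tmom n = a n - 0 ^ n := by
  obtain ⟨R, hR, hfR⟩ := hf
  obtain ⟨m, hm⟩ := Nat.exists_eq_add_of_le (Nat.succ_le_of_lt hn)
  rw [Nat.succ_eq_add_one] at hm
  refine tmom_eq_of_momentKernel_eq (c := a n) (b := fun k ↦ (a (n - 1 - k) : ℂ))
    (R := fun z ↦ ∑ k ∈ Finset.range m, (a (n + 1 + k) : ℂ) * z ^ k + z ^ m * R z)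
    (by fun_prop) fun z hz ↦ ?_
  have hz0 : z ≠ 0 := hz.2
  have hlow : ∑ k ∈ Finset.range n, (a (n - 1 - k) : ℂ) * (z ^ (k + 2))⁻¹
      = (∑ k ∈ Finset.range n, (a k : ℂ) * z ^ k) / z ^ (n + 1) := by
    rw [← Finset.sum_range_reflect (fun k ↦ (a k : ℂ) * z ^ k), Finset.sum_div]
    refine Finset.sum_congr rfl fun k hk ↦ ?_
    have hk' : n + 1 = (n - 1 - k) + (k + 2) := by have := Finset.mem_range.1 hk; omega
    rw [show z ^ (n + 1) = z ^ (n - 1 - k) * z ^ (k + 2) by rw [← pow_add, ← hk']]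
    field_simp
  rw [h z hz, hfR z hz.1, hlow, hm, Finset.sum_range_add, Finset.sum_range_succ]
  simp only [pow_add z (n + 1), mul_left_comm _ (z ^ (n + 1)), ← Finset.mul_sum]
  push_cast
  field_simp
  ring

theorem exists_tmom_factorization : ∃ A B : ℂ → ℂ,
    (∀ z, 1 - exp z = z * B z) ∧ (∀ z, z + 1 - exp z = z ^ 2 * A z) ∧
    HasSexticExpansion A (fun k ↦ -1 / (k + 2).factorial) ∧
    HasSexticExpansion B (fun k ↦ -1 / (k + 1).factorial) ∧
    (∀ z ∈ closedStrip, A z ≠ 0) ∧ ∀ z ∈ closedStrip, B z ≠ 0 := by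
  obtain ⟨E, hE, hexp⟩ := exists_differentiable_exp_eq_sum_add 7
  set A : ℂ → ℂ := fun z ↦
    ∑ k ∈ Finset.range 6, ((-1 / (k + 2).factorial : ℚ) : ℂ) * z ^ k + z ^ 6 * -E z with hA
  set B : ℂ → ℂ := fun z ↦
    ∑ k ∈ Finset.range 6, ((-1 / (k + 1).factorial : ℚ) : ℂ) * z ^ k
      + z ^ 6 * (-1 / 5040 - z * E z) with hB
  have hAz : ∀ z, z + 1 - exp z = z ^ 2 * A z := by
    intro z
    rw [hexp z, hA]
    simp only [Finset.sum_range_succ, Finset.sum_range_zero]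
    norm_num [Nat.factorial]
    ring
  have hBz : ∀ z, 1 - exp z = z * B z := by
    intro z
    rw [hexp z, hB]
    simp only [Finset.sum_range_succ, Finset.sum_range_zero]
    norm_num [Nat.factorial]
    ring
  refine ⟨A, B, hBz, hAz, ⟨_, by fun_prop, fun z _ ↦ rfl⟩, ⟨_, by fun_prop, fun z _ ↦ rfl⟩,
    fun z hz h ↦ ?_, fun z hz h ↦ ?_⟩
  · have h0 : z = 0 := eq_zero_of_exp_eq_one_add_of_mem_closedStrip hz
      (by linear_combination -hAz z - z ^ 2 * h)
    rw [h0, hA] at h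
    norm_num [Finset.sum_range_succ] at h
  · have h0 : z = 0 := eq_zero_of_exp_eq_one_of_mem_closedStrip hz
      (by linear_combination -hBz z - z * h)
    rw [h0, hB] at h
    norm_num [Finset.sum_range_succ] at h

end Expansions

/-- The first six moments: `t₀ = 1`, `t₁ = 2/3`, `t₂ = 5/9`, `t₃ = 67/135`,
`t₄ = 371/810`, `t₅ = 1465/3402`. -/
theorem tmom_values :
    tmom 0 = 1 ∧ tmom 1 = 2 / 3 ∧ tmom 2 = 5 / 9 ∧ tmom 3 = 67 / 135 ∧
    tmom 4 = 371 / 810 ∧ tmom 5 = 1465 / 3402 := by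
  obtain ⟨A, B, hB, hA, hAe, hBe, hA0, hB0⟩ := exists_tmom_factorization
  have hker : ∀ n, ∀ z ∈ closedStrip \ {0},
      momentKernel n z = (fun z ↦ B z / A z / B z ^ n) z / z ^ (n + 1) := by
    intro n z hz
    have hz0 : z ≠ 0 := hz.2
    have h1 := hA0 z hz.1
    have h2 := hB0 z hz.1
    rw [momentKernel, hA, hB, mul_pow]
    field_simp
    ring
  have hstep : ∀ {n : ℕ} {a q : ℕ → ℚ}, HasSexticExpansion (fun z ↦ B z / A z / B z ^ n) a →
      (∀ k < 6, ∑ ij ∈ Finset.HasAntidiagonal.antidiagonal k, q ij.1 * (-1 / (ij.2 + 1).factorial) = a k) →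
      HasSexticExpansion (fun z ↦ B z / A z / B z ^ (n + 1)) q := by
    intro n a q h hq
    simpa only [pow_succ, div_mul_eq_div_div] using h.div hBe hB0 hq
  have h0 : HasSexticExpansion (fun z ↦ B z / A z / B z ^ 0)
      (fun k ↦ ([2, 1 / 3, 1 / 18, 1 / 270, -1 / 3240, -1 / 13608] : List ℚ).getD k 0) := by
    simp only [pow_zero, div_one]
    refine hBe.div hAe hA0 fun k hk ↦ ?_
    interval_cases k <;>
      norm_num [Finset.Nat.sum_antidiagonal_eq_sum_range_succ_mk, Finset.sum_range_succ,
        Nat.factorial]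
  have h1 : HasSexticExpansion (fun z ↦ B z / A z / B z ^ 1)
      (fun k ↦ ([-2, 2 / 3, -1 / 18, -1 / 270, 1 / 3240, 1 / 13608] : List ℚ).getD k 0) := by
    refine hstep h0 fun k hk ↦ ?_
    interval_cases k <;>
      norm_num [Finset.Nat.sum_antidiagonal_eq_sum_range_succ_mk, Finset.sum_range_succ,
        Nat.factorial]
  have h2 : HasSexticExpansion (fun z ↦ B z / A z / B z ^ 2)
      (fun k ↦ ([2, -5 / 3, 5 / 9, -43 / 540, -1 / 3240, 179 / 136080] : List ℚ).getD k 0) := by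
    refine hstep h1 fun k hk ↦ ?_
    interval_cases k <;>
      norm_num [Finset.Nat.sum_antidiagonal_eq_sum_range_succ_mk, Finset.sum_range_succ,
        Nat.factorial]
  have h3 : HasSexticExpansion (fun z ↦ B z / A z / B z ^ 3)
      (fun k ↦ ([-2, 8 / 3, -14 / 9, 67 / 135, -269 / 3240, 97 / 34020] : List ℚ).getD k 0) := by
    refine hstep h2 fun k hk ↦ ?_
    interval_cases k <;>
      norm_num [Finset.Nat.sum_antidiagonal_eq_sum_range_succ_mk, Finset.sum_range_succ,
        Nat.factorial]
  have h4 : HasSexticExpansion (fun z ↦ B z / A z / B z ^ 4)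
      (fun k ↦ ([2, -11 / 3, 55 / 18, -202 / 135, 371 / 810, -11161 / 136080] : List ℚ).getD k 0) := by
    refine hstep h3 fun k hk ↦ ?_
    interval_cases k <;>
      norm_num [Finset.Nat.sum_antidiagonal_eq_sum_range_succ_mk, Finset.sum_range_succ,
        Nat.factorial]
  have h5 : HasSexticExpansion (fun z ↦ B z / A z / B z ^ 5)
      (fun k ↦ ([-2, 14 / 3, -91 / 18, 899 / 270, -1181 / 810, 1465 / 3402] : List ℚ).getD k 0) := by
    refine hstep h4 fun k hk ↦ ?_
    interval_cases k <;>
      norm_num [Finset.Nat.sum_antidiagonal_eq_sum_range_succ_mk, Finset.sum_range_succ,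
        Nat.factorial]
  refine ⟨?_, ?_, ?_, ?_, ?_, ?_⟩
  · rw [tmom_eq_of_hasSexticExpansion h0 (by norm_num) (hker 0)]; norm_num
  · rw [tmom_eq_of_hasSexticExpansion h1 (by norm_num) (hker 1)]; norm_num
  · rw [tmom_eq_of_hasSexticExpansion h2 (by norm_num) (hker 2)]; norm_num
  · rw [tmom_eq_of_hasSexticExpansion h3 (by norm_num) (hker 3)]; norm_num
  · rw [tmom_eq_of_hasSexticExpansion h4 (by norm_num) (hker 4)]; norm_num
  · rw [tmom_eq_of_hasSexticExpansion h5 (by norm_num) (hker 5)]; norm_num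
end
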